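/- arXiv:math/0505167 — 14 statements merged into one kernel-verified Lean document; each statement's English description precedes it below -/
import Mathlib

section
/- For all natural numbers n and k, the product n! · k! · (n+k)! divides (2n)! · (2k)!; equivalently, (2n)!(2k)!/(n!·k!·(n+k)!) is a natural number. -/
open Nat

/-- The quotients `S n k = (2n)! (2k)! / (n! k! (n+k)!)` satisfy `S n (k+1) = 4 S n k - S (n+1) k`,
so integrality follows by induction on `k` from that of the central binomial coefficients. -/
theorem factorial_ratio_catalan (n k : ℕ) :
    n ! * k ! * (n + k)! ∣ (2 * n)! * (2 * k)! := by
  induction k generalizing n with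
  | zero =>
    simpa [two_mul] using Nat.factorial_mul_factorial_dvd_factorial_add n n
  | succ k ih =>
    obtain ⟨a, ha⟩ := ih n
    obtain ⟨b, hb⟩ := ih (n + 1)
    rw [show 2 * (n + 1) = 2 * n + 1 + 1 by ring, show n + 1 + k = n + k + 1 by ring] at hb
    rw [show 2 * (k + 1) = 2 * k + 1 + 1 by ring, ← Nat.add_assoc n k 1, ← Int.natCast_dvd_natCast]
    simp only [Nat.factorial_succ] at hb ⊢
    zify at ha hb
    push_cast
    have hn : (n + 1 : ℤ) ≠ 0 := by positivity
    have hb' : 2 * (2 * n + 1) * ((2 * n)! * (2 * k)! : ℤ)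
        = (n + k + 1) * (n ! * k ! * (n + k)!) * b := by
      apply mul_left_cancel₀ hn
      linear_combination hb
    refine ⟨4 * a - b, ?_⟩
    linear_combination (k + 1 : ℤ) * (4 * (n + k + 1) * ha - hb')
end

section
/- (Landau) Let S be a finite index set, and for each u ∈ S let a linear form on ℝ^d with natural-number coefficients be given (specified by a coefficient vector c_u ∈ ℕ^d, so u(X) = Σ_{j} c_u(j)·x_j), together with a sign ε_u ∈ {+1, −1}. Then the following are equivalent: (1) for every X ∈ ℕ^d, the product of (u(X))! over those u ∈ S with ε_u = −1 divides the product of (u(X))! over those u with ε_u = +1; (2) for every X ∈ [0,1]^d ⊂ ℝ^d, Σ_{u∈S} ε_u·⌊u(X)⌋ ≥ 0. -/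
open Nat Finset

theorem sum_sign_mul_eq_sum_filter_sub {ι : Type*} [Fintype ι] (ε : ι → ℤ)
    (hε : ∀ u, ε u = 1 ∨ ε u = -1) (g : ι → ℤ) :
    ∑ u, ε u * g u = ∑ u ∈ Finset.univ.filter (fun u => ε u = 1), g u -
      ∑ u ∈ Finset.univ.filter (fun u => ε u = -1), g u := by
  rw [Finset.sum_filter, Finset.sum_filter, ← Finset.sum_sub_distrib]
  refine Finset.sum_congr rfl fun u _ => ?_
  rcases hε u with h | h <;> simp [h]

theorem prod_factorial_dvd_prod_factorial_iff {ι : Type*} [Fintype ι] (ε : ι → ℤ)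
    (hε : ∀ u, ε u = 1 ∨ ε u = -1) (n : ι → ℕ) :
    (∏ u ∈ Finset.univ.filter (fun u => ε u = -1), (n u)!) ∣
        ∏ u ∈ Finset.univ.filter (fun u => ε u = 1), (n u)! ↔
      ∀ p : ℕ, p.Prime → 0 ≤ ∑ u, ε u * ((n u)!.factorization p : ℤ) := by
  rw [← Nat.factorization_prime_le_iff_dvd
    (Finset.prod_ne_zero_iff.2 fun u _ => Nat.factorial_ne_zero _)
    (Finset.prod_ne_zero_iff.2 fun u _ => Nat.factorial_ne_zero _)]
  refine forall₂_congr fun p _ => ?_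
  rw [Nat.factorization_prod fun u _ => Nat.factorial_ne_zero _,
    Nat.factorization_prod fun u _ => Nat.factorial_ne_zero _,
    sum_sign_mul_eq_sum_filter_sub ε hε, sub_nonneg, Finsupp.finsetSum_apply,
    Finsupp.finsetSum_apply]
  exact_mod_cast Iff.rfl

theorem natCast_div_eq_floor (m n : ℕ) : ((m / n : ℕ) : ℤ) = ⌊(m : ℝ) / n⌋ := by
  rw [Int.floor_div_natCast, Int.floor_natCast, Int.natCast_div]

theorem sum_sign_mul_div_nonneg {d : ℕ} {ι : Type*} [Fintype ι]
    (c : ι → Fin d → ℕ) (ε : ι → ℤ)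
    (h : ∀ X : Fin d → ℝ, (∀ j, X j ∈ Set.Icc (0 : ℝ) 1) →
      0 ≤ ∑ u, ε u * ⌊∑ j, (c u j : ℝ) * X j⌋)
    (X : Fin d → ℕ) {q : ℕ} (hq : 0 < q) :
    0 ≤ ∑ u, ε u * (((∑ j, c u j * X j) / q : ℕ) : ℤ) := by
  have hcoeff (j : Fin d) : 0 ≤ ∑ u, ε u * (c u j : ℤ) := by
    have := h (Pi.single j 1) fun k => by
      by_cases hk : k = j
      · subst hk; simp
      · simp [hk]
    simpa [Pi.single_apply] using this
  have hfrac : 0 ≤ ∑ u, ε u * (((∑ j, c u j * (X j % q)) / q : ℕ) : ℤ) := by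
    have hq' : (0 : ℝ) < q := by exact_mod_cast hq
    have := h (fun j => ((X j % q : ℕ) : ℝ) / q) fun j =>
      ⟨by positivity, (div_le_one hq').2 (by exact_mod_cast (Nat.mod_lt _ hq).le)⟩
    convert this using 4 with u
    rw [natCast_div_eq_floor]
    push_cast
    rw [Finset.sum_div]
    simp only [mul_div_assoc]
  have hsplit (u : ι) : (∑ j, c u j * X j) / q =
      (∑ j, c u j * (X j % q)) / q + ∑ j, c u j * (X j / q) := by
    rw [← Nat.add_mul_div_left _ _ hq, Finset.mul_sum, ← Finset.sum_add_distrib]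
    congr 1
    refine Finset.sum_congr rfl fun j _ => ?_
    conv_lhs => rw [← Nat.mod_add_div (X j) q]
    ring
  have hint : 0 ≤ ∑ u, ε u * ((∑ j, c u j * (X j / q) : ℕ) : ℤ) := by
    have : ∑ u, ε u * ((∑ j, c u j * (X j / q) : ℕ) : ℤ) =
        ∑ j, (∑ u, ε u * (c u j : ℤ)) * ((X j / q : ℕ) : ℤ) := by
      push_cast
      simp only [Finset.mul_sum, Finset.sum_mul]
      rw [Finset.sum_comm]
      simp only [mul_assoc]
    rw [this]
    exact Finset.sum_nonneg fun j _ => mul_nonneg (hcoeff j) (Int.natCast_nonneg _)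
  simp only [hsplit, Nat.cast_add, mul_add, Finset.sum_add_distrib]
  exact add_nonneg hfrac hint

theorem factorization_factorial_eq_div_of_lt_sq {p n : ℕ} (hp : p.Prime) (hn : n < p ^ 2) :
    (n)!.factorization p = n / p := by
  rw [Nat.factorization_factorial hp (Nat.log_lt_of_lt_pow' two_ne_zero hn)]
  simp

theorem eventually_div_natCeil_eq_floor {d : ℕ} (c : Fin d → ℕ) {X : Fin d → ℝ}
    (hX : ∀ j, 0 ≤ X j) :
    ∀ᶠ p : ℕ in Filter.atTop,
      (((∑ j, c j * ⌈p * X j⌉₊) / p : ℕ) : ℤ) = ⌊∑ j, (c j : ℝ) * X j⌋ := by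
  set x := ∑ j, (c j : ℝ) * X j with hx
  set C : ℝ := ∑ j, (c j : ℝ) with hC
  have hgap : 0 < (⌊x⌋ : ℝ) + 1 - x := sub_pos.2 (Int.lt_floor_add_one x)
  have hlim := tendsto_const_div_atTop_nhds_zero_nat C
  filter_upwards [hlim.eventually_lt_const hgap, Filter.eventually_gt_atTop 0] with p hp hp0
  have hp0' : (0 : ℝ) < p := by exact_mod_cast hp0
  have hlow : p * x ≤ ∑ j, (c j : ℝ) * (⌈p * X j⌉₊ : ℝ) := by
    rw [hx, Finset.mul_sum]
    refine Finset.sum_le_sum fun j _ => ?_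
    rw [mul_left_comm]
    exact mul_le_mul_of_nonneg_left (Nat.le_ceil _) (Nat.cast_nonneg _)
  have hupp : ∑ j, (c j : ℝ) * (⌈p * X j⌉₊ : ℝ) ≤ p * x + C := by
    rw [hx, hC, Finset.mul_sum, ← Finset.sum_add_distrib]
    refine Finset.sum_le_sum fun j _ => ?_
    calc (c j : ℝ) * (⌈p * X j⌉₊ : ℝ) ≤ c j * (p * X j + 1) :=
          mul_le_mul_of_nonneg_left
            (Nat.ceil_lt_add_one (mul_nonneg hp0'.le (hX j))).le (Nat.cast_nonneg _)
      _ = p * (c j * X j) + c j := by ring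
  rw [natCast_div_eq_floor, Int.floor_eq_iff]
  push_cast
  rw [le_div_iff₀ hp0', div_lt_iff₀ hp0']
  rw [div_lt_iff₀ hp0'] at hp
  have := mul_le_mul_of_nonneg_right (Int.floor_le x) hp0'.le
  constructor <;> nlinarith

/-- **Landau's theorem** on integer ratios of factorials.  Given a finite
family of linear forms `u(X) = ∑ j, c u j * X j` on `ℝ^d` with coefficients
in `ℕ`, each equipped with a sign `ε u = ±1`, the ratio of factorials
`∏ u, (u(X))! ^ (ε u)` is a natural number for all `X ∈ ℕ^d` if and only if
`∑ u, ε u * ⌊u(X)⌋ ≥ 0` for all `X ∈ [0,1]^d`. -/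
theorem landau_factorial_ratios {d : ℕ} {ι : Type*} [Fintype ι] [DecidableEq ι]
    (c : ι → Fin d → ℕ) (ε : ι → ℤ) (hε : ∀ u, ε u = 1 ∨ ε u = -1) :
    (∀ X : Fin d → ℕ,
        (∏ u ∈ Finset.univ.filter fun u => ε u = -1, (∑ j, c u j * X j)!) ∣
          ∏ u ∈ Finset.univ.filter fun u => ε u = 1, (∑ j, c u j * X j)!) ↔
      (∀ X : Fin d → ℝ, (∀ j, X j ∈ Set.Icc (0 : ℝ) 1) →
        0 ≤ ∑ u, ε u * ⌊∑ j, (c u j : ℝ) * X j⌋) := by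
  simp only [prod_factorial_dvd_prod_factorial_iff ε hε]
  constructor
  · intro h X hX
    have hfloor := Filter.eventually_all.2 fun u =>
      eventually_div_natCeil_eq_floor (c u) (X := X) fun j => (hX j).1
    have hlarge := Filter.eventually_all.2 fun u =>
      Filter.eventually_gt_atTop (∑ j, c u j)
    obtain ⟨p, hp, hpfloor, hplarge⟩ :=
      (Nat.frequently_atTop_iff_infinite.2 Nat.infinite_setOfPred_prime).and_eventually
        (hfloor.and hlarge) |>.exists
    replace hp : p.Prime := hp
    have hbound (u : ι) : ∑ j, c u j * ⌈p * X j⌉₊ < p ^ 2 := by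
      calc ∑ j, c u j * ⌈p * X j⌉₊ ≤ ∑ j, c u j * p :=
            Finset.sum_le_sum fun j _ => Nat.mul_le_mul_left _ <|
              Nat.ceil_le.2 (mul_le_of_le_one_right (Nat.cast_nonneg _) (hX j).2)
        _ = (∑ j, c u j) * p := (Finset.sum_mul ..).symm
        _ < p * p := Nat.mul_lt_mul_of_pos_right (hplarge u) hp.pos
        _ = p ^ 2 := (sq p).symm
    simpa only [factorization_factorial_eq_div_of_lt_sq hp (hbound _), hpfloor] using
      h (fun j => ⌈p * X j⌉₊) p hp
  · intro h X p hp
    have hlog (u : ι) : Nat.log p (∑ j, c u j * X j) < (∑ v, ∑ j, c v j * X j) + 1 :=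
      Nat.lt_succ_of_le <| (Nat.log_le_self _ _).trans <|
        Finset.single_le_sum (f := fun v => ∑ j, c v j * X j)
          (fun _ _ => Nat.zero_le _) (Finset.mem_univ u)
    simp only [Nat.factorization_factorial hp (hlog _), Nat.cast_sum, Finset.mul_sum]
    rw [Finset.sum_comm]
    exact Finset.sum_nonneg fun i _ => sum_sign_mul_div_nonneg c ε h X (pow_pos hp.pos i)
end

section
/- For all natural numbers n and k, the product (2n+k)! · (n+2k)! · n! · k! divides (4n)! · (4k)!; equivalently, (4n)!(4k)!/((2n+k)!(n+2k)!·n!·k!) is a natural number. -/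
open Nat

theorem landau_floor_of_lt {q r s : ℕ} (hr : r < q) (hs : s < q) :
    (2 * r + s) / q + (r + 2 * s) / q ≤ 4 * r / q + 4 * s / q := by
  have hq : 0 < q := by omega
  have bounds (m : ℕ) : q * (m / q) ≤ m ∧ m < q * (m / q) + q :=
    ⟨Nat.mul_div_le m q, Nat.lt_mul_div_succ m hq⟩
  obtain ⟨a₁, a₂⟩ := bounds (2 * r + s)
  obtain ⟨b₁, b₂⟩ := bounds (r + 2 * s)
  obtain ⟨c₁, c₂⟩ := bounds (4 * r)
  obtain ⟨d₁, d₂⟩ := bounds (4 * s)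
  have ha : (2 * r + s) / q < 3 := (Nat.div_lt_iff_lt_mul hq).2 (by omega)
  have hb : (r + 2 * s) / q < 3 := (Nat.div_lt_iff_lt_mul hq).2 (by omega)
  have hc : 4 * r / q < 4 := (Nat.div_lt_iff_lt_mul hq).2 (by omega)
  have hd : 4 * s / q < 4 := (Nat.div_lt_iff_lt_mul hq).2 (by omega)
  generalize (2 * r + s) / q = a at *
  generalize (r + 2 * s) / q = b at *
  generalize 4 * r / q = c at *
  generalize 4 * s / q = d at *
  interval_cases a <;> interval_cases b <;> interval_cases c <;> interval_cases d <;> omega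

theorem landau_floor {q : ℕ} (hq : 0 < q) (n k : ℕ) :
    (2 * n + k) / q + (n + 2 * k) / q + n / q + k / q ≤ 4 * n / q + 4 * k / q := by
  have key := landau_floor_of_lt (Nat.mod_lt n hq) (Nat.mod_lt k hq)
  have hn := Nat.mod_add_div n q
  have hk := Nat.mod_add_div k q
  have h₁ : (2 * n + k) / q = (2 * (n % q) + k % q) / q + (2 * (n / q) + k / q) := by
    rw [← Nat.add_mul_div_left _ _ hq]; congr 1; linarith
  have h₂ : (n + 2 * k) / q = (n % q + 2 * (k % q)) / q + (n / q + 2 * (k / q)) := by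
    rw [← Nat.add_mul_div_left _ _ hq]; congr 1; linarith
  have h₃ : 4 * n / q = 4 * (n % q) / q + 4 * (n / q) := by
    rw [← Nat.add_mul_div_left _ _ hq]; congr 1; linarith
  have h₄ : 4 * k / q = 4 * (k % q) / q + 4 * (k / q) := by
    rw [← Nat.add_mul_div_left _ _ hq]; congr 1; linarith
  omega

theorem factorial_ratio_landau (n k : ℕ) :
    (2 * n + k)! * (n + 2 * k)! * n ! * k ! ∣ (4 * n)! * (4 * k)! := by
  have hne (m : ℕ) : m ! ≠ 0 := Nat.factorial_ne_zero m
  rw [← Nat.factorization_prime_le_iff_dvd (by simp [hne]) (by simp [hne])]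
  intro p hp
  have legendre {m : ℕ} (hm : m ≤ 4 * (n + k)) :
      (m !).factorization p = ∑ i ∈ Finset.Ico 1 (Nat.log p (4 * (n + k)) + 1), m / p ^ i :=
    Nat.factorization_factorial hp (Nat.lt_succ_of_le (Nat.log_mono_right hm))
  simp only [Nat.factorization_mul, ne_eq, mul_eq_zero, hne, or_self, not_false_eq_true,
    Finsupp.add_apply]
  rw [legendre (by omega), legendre (by omega), legendre (by omega), legendre (by omega),
    legendre (by omega), legendre (by omega)]
  simp only [← Finset.sum_add_distrib]
  exact Finset.sum_le_sum fun i _ => landau_floor (pow_pos hp.pos i) n k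
end

section
/- (Picon) For all natural numbers n and k, the product (n!)^2 · (k!)^2 · ((n+k)!)^2 · (2n+2k)! divides (2n)! · (4k)! · (4n+2k)!. -/
open Nat

/-- The residual case `r, s < q` of the floor inequality used with the Legendre formula. -/
lemma picon_floor_le_of_lt {q r s : ℕ} (hr : r < q) (hs : s < q) :
    2 * ((r + s) / q) + (2 * r + 2 * s) / q ≤
      2 * r / q + 4 * s / q + (4 * r + 2 * s) / q := by
  have hq : 0 < q := by omega
  have bounds (x : ℕ) : q * (x / q) ≤ x ∧ x < q * (x / q + 1) :=
    ⟨Nat.mul_div_le x q, Nat.lt_mul_div_succ x hq⟩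
  have hu : (r + s) / q < 2 := Nat.div_lt_of_lt_mul (by omega)
  have hv : (2 * r + 2 * s) / q < 4 := Nat.div_lt_of_lt_mul (by omega)
  have ha : 2 * r / q < 2 := Nat.div_lt_of_lt_mul (by omega)
  have hb : 4 * s / q < 4 := Nat.div_lt_of_lt_mul (by omega)
  have hc : (4 * r + 2 * s) / q < 6 := Nat.div_lt_of_lt_mul (by omega)
  have hu' := bounds (r + s)
  have hv' := bounds (2 * r + 2 * s)
  have ha' := bounds (2 * r)
  have hb' := bounds (4 * s)
  have hc' := bounds (4 * r + 2 * s)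
  generalize (r + s) / q = u at *
  generalize (2 * r + 2 * s) / q = v at *
  generalize 2 * r / q = a at *
  generalize 4 * s / q = b at *
  generalize (4 * r + 2 * s) / q = c at *
  clear bounds
  interval_cases u <;> interval_cases v <;> interval_cases a <;> interval_cases b <;>
    interval_cases c <;> omega

lemma picon_floor_le {q : ℕ} (hq : 0 < q) (n k : ℕ) :
    2 * (n / q) + 2 * (k / q) + 2 * ((n + k) / q) + (2 * n + 2 * k) / q ≤
      2 * n / q + 4 * k / q + (4 * n + 2 * k) / q := by
  have key := picon_floor_le_of_lt (Nat.mod_lt n hq) (Nat.mod_lt k hq)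
  have div_eq (x y c d : ℕ) (h : x = y + q * c) (hd : d = y / q + c) : x / q = d := by
    rw [h, hd, Nat.add_mul_div_left y c hq]
  have hn := Nat.mod_add_div n q
  have hk := Nat.mod_add_div k q
  rw [div_eq (n + k) (n % q + k % q) (n / q + k / q) _ (by linarith) rfl,
    div_eq (2 * n + 2 * k) (2 * (n % q) + 2 * (k % q)) (2 * (n / q) + 2 * (k / q)) _
      (by linarith) rfl,
    div_eq (2 * n) (2 * (n % q)) (2 * (n / q)) _ (by linarith) rfl,
    div_eq (4 * k) (4 * (k % q)) (4 * (k / q)) _ (by linarith) rfl,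
    div_eq (4 * n + 2 * k) (4 * (n % q) + 2 * (k % q)) (4 * (n / q) + 2 * (k / q)) _
      (by linarith) rfl]
  omega

theorem factorial_ratio_picon_one (n k : ℕ) :
    (n !) ^ 2 * (k !) ^ 2 * ((n + k)!) ^ 2 * (2 * n + 2 * k)! ∣
      (2 * n)! * (4 * k)! * (4 * n + 2 * k)! := by
  rw [← Nat.factorization_prime_le_iff_dvd (by positivity) (by positivity)]
  intro p hp
  have legendre (m : ℕ) (hm : m ≤ 4 * n + 4 * k) :
      (m !).factorization p = ∑ i ∈ Finset.Ico 1 (4 * n + 4 * k + 1), m / p ^ i :=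
    Nat.factorization_factorial hp
      (Nat.lt_succ_of_le ((Nat.log_le_self p m).trans hm))
  have ne (m : ℕ) : m ! ≠ 0 := m.factorial_ne_zero
  simp only [Nat.factorization_mul, Nat.factorization_pow, ne, ne_eq, mul_eq_zero,
    pow_eq_zero_iff, not_false_eq_true, or_self, Finsupp.add_apply,
    Finsupp.smul_apply, smul_eq_mul, OfNat.ofNat_ne_zero]
  rw [legendre n (by omega), legendre k (by omega), legendre (n + k) (by omega),
    legendre (2 * n + 2 * k) (by omega), legendre (2 * n) (by omega),
    legendre (4 * k) (by omega), legendre (4 * n + 2 * k) (by omega)]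
  simp only [Finset.mul_sum, ← Finset.sum_add_distrib]
  exact Finset.sum_le_sum fun i _ => picon_floor_le (pow_pos hp.pos i) n k
end

section
/- (Picon) For all natural numbers n and k, the product (3n)! · (4n)! · (3k)! · (4k)! · ((n+k)!)^6 divides (12n)! · n! · (12k)! · k!. -/
open Nat

theorem div_add_div_le_div_twelve (N K : ℕ) :
    N / 4 + N / 3 + (K / 4 + K / 3) + 6 * ((N + K + 1) / 12) ≤
      N + N / 12 + (K + K / 12) := by
  obtain ⟨a, r, hr, rfl⟩ : ∃ a r, r < 12 ∧ N = 12 * a + r :=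
    ⟨N / 12, N % 12, Nat.mod_lt _ (by norm_num), (Nat.div_add_mod N 12).symm⟩
  interval_cases r <;> omega

theorem factorial_ratio_floor_inequality (n k : ℕ) {q : ℕ} (hq : 0 < q) :
    3 * n / q + 4 * n / q + 3 * k / q + 4 * k / q + 6 * ((n + k) / q) ≤
      12 * n / q + n / q + 12 * k / q + k / q := by
  have h₁ (m : ℕ) : m / q = 12 * m / q / 12 := by
    rw [Nat.div_div_eq_div_mul, mul_comm q, Nat.mul_div_mul_left _ _ (by norm_num)]
  have h₃ (m : ℕ) : 3 * m / q = 12 * m / q / 4 := by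
    rw [Nat.div_div_eq_div_mul, mul_comm q, show 12 * m = 4 * (3 * m) by ring,
      Nat.mul_div_mul_left _ _ (by norm_num)]
  have h₄ (m : ℕ) : 4 * m / q = 12 * m / q / 3 := by
    rw [Nat.div_div_eq_div_mul, mul_comm q, show 12 * m = 3 * (4 * m) by ring,
      Nat.mul_div_mul_left _ _ (by norm_num)]
  have hadd : 12 * (n + k) / q ≤ 12 * n / q + 12 * k / q + 1 := by
    rw [mul_add, Nat.add_div hq]
    split_ifs <;> omega
  have hsum := Nat.div_le_div_right (c := 12) hadd
  have hfloor := div_add_div_le_div_twelve (12 * n / q) (12 * k / q)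
  rw [h₃ n, h₄ n, h₃ k, h₄ k, h₁ n, h₁ k, h₁ (n + k)]
  omega

theorem factorial_ratio_picon_two (n k : ℕ) :
    (3 * n)! * (4 * n)! * (3 * k)! * (4 * k)! * ((n + k)!) ^ 6 ∣
      (12 * n)! * n ! * (12 * k)! * k ! := by
  have hne := Nat.factorial_ne_zero
  rw [← Nat.factorization_prime_le_iff_dvd (by simp [hne]) (by simp [hne])]
  intro p hp
  have hlegendre (m : ℕ) (hm : m ≤ 12 * (n + k)) : (m !).factorization p =
      ∑ i ∈ Finset.Ico 1 (Nat.log p (12 * (n + k)) + 1), m / p ^ i :=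
    Nat.factorization_factorial hp (Nat.lt_succ_of_le (Nat.log_mono_right hm))
  simp only [Nat.factorization_mul, Nat.factorization_pow, hne, ne_eq, mul_eq_zero, pow_eq_zero_iff,
    or_self, not_false_eq_true, Finsupp.add_apply, Finsupp.smul_apply, smul_eq_mul,
    OfNat.ofNat_ne_zero]
  rw [hlegendre (3 * n) (by omega), hlegendre (4 * n) (by omega), hlegendre (3 * k) (by omega),
    hlegendre (4 * k) (by omega), hlegendre (n + k) (by omega), hlegendre (12 * n) (by omega),
    hlegendre n (by omega), hlegendre (12 * k) (by omega), hlegendre k (by omega)]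
  simp only [Finset.mul_sum, ← Finset.sum_add_distrib]
  exact Finset.sum_le_sum fun i _ => factorial_ratio_floor_inequality n k (pow_pos hp.pos i)
end

section
/- (Lawrence) Let T = (ℝ/ℤ)^d be the d-dimensional torus, realized as the d-fold product of the additive circle ℝ/ℤ, and let U ⊆ T be an open subset. Consider the collection 𝒞 of all closed (topological) additive subgroups L of T such that L ∩ U = ∅. Then the set of maximal elements of 𝒞 with respect to inclusion is finite. -/
theorem UnitAddTorus.mFourier_apply_add {ι : Type*} [Fintype ι] (n : ι → ℤ)
    (x y : UnitAddTorus ι) : mFourier n (x + y) = mFourier n x * mFourier n y := by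
  simp [mFourier, Finset.prod_mul_distrib, AddCircle.toCircle_add]

open MeasureTheory in
/-- A point outside a closed subgroup of the torus is separated from it by a character. -/
theorem UnitAddTorus.exists_mFourier_ne_one_of_notMem {ι : Type*} [Fintype ι]
    {L : AddSubgroup (UnitAddTorus ι)} (hL : IsClosed (L : Set (UnitAddTorus ι)))
    {x : UnitAddTorus ι} (hx : x ∉ L) :
    ∃ n : ι → ℤ, (∀ l ∈ L, mFourier n l = 1) ∧ mFourier n x ≠ 1 := by
  by_contra! H
  have : CompactSpace L := isCompact_iff_compactSpace.mp hL.isCompact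
  let _ : MeasurableSpace L := borel L
  have : BorelSpace L := ⟨rfl⟩
  let μ : Measure L := Measure.addHaarMeasure ⊤
  have : IsProbabilityMeasure μ := ⟨Measure.addHaarMeasure_self⟩
  have hint (f : C(UnitAddTorus ι, ℂ)) (y : UnitAddTorus ι) :
      Integrable (fun l : L => f (y + l)) μ :=
    Continuous.integrable_of_hasCompactSupport (by fun_prop)
      (HasCompactSupport.of_compactSpace _)
  have hspan : ∀ g ∈ Submodule.span ℂ (Set.range (mFourier (d := ι))),
      ∫ l : L, g (0 + l) ∂μ = ∫ l : L, g (x + l) ∂μ := by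
    intro g hg
    induction hg using Submodule.span_induction with
    | mem g hg =>
      obtain ⟨n, rfl⟩ := hg
      simp only [mFourier_apply_add, integral_const_mul]
      by_cases hn : ∀ l ∈ L, mFourier n l = 1
      · rw [H n hn, hn 0 L.zero_mem]
      · push Not at hn
        obtain ⟨a, ha, hna⟩ := hn
        have hinv := integral_add_left_eq_self (μ := μ) (fun l : L => mFourier n l) ⟨a, ha⟩
        simp only [AddSubgroup.coe_add, mFourier_apply_add, integral_const_mul] at hinv
        rw [(mul_left_eq_self₀.mp hinv).resolve_left hna, mul_zero, mul_zero]
    | zero => simp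
    | add g h _ _ hg hh =>
      simp only [ContinuousMap.add_apply]
      rw [integral_add (hint g 0) (hint h 0), integral_add (hint g x) (hint h x), hg, hh]
    | smul c g _ hg => simp only [ContinuousMap.smul_apply, integral_smul, hg]
  have hdisj : Disjoint (L : Set (UnitAddTorus ι)) ((x + ·) '' (L : Set (UnitAddTorus ι))) := by
    rw [Set.disjoint_left]
    rintro _ h ⟨l, hl, rfl⟩
    exact hx ((L.add_mem_cancel_right hl).mp h)
  obtain ⟨f, hf0, hf1, -⟩ := exists_continuous_zero_one_of_isClosed hL
    (hL.isCompact.image (by fun_prop : Continuous (x + ·))).isClosed hdisj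
  let F : C(UnitAddTorus ι, ℂ) := ⟨fun y => (f y : ℂ), by fun_prop⟩
  have hF : F ∈ closure (Submodule.span ℂ (Set.range (mFourier (d := ι))) :
      Set C(UnitAddTorus ι, ℂ)) := by
    rw [← Submodule.topologicalClosure_coe, span_mFourier_closure_eq_top]
    trivial
  obtain ⟨g, hg, hFg⟩ := Metric.mem_closure_iff.mp hF (1 / 4) (by norm_num)
  have hclose (y : UnitAddTorus ι) :
      ‖∫ l : L, F (y + l) ∂μ - ∫ l : L, g (y + l) ∂μ‖ ≤ 1 / 4 := by
    rw [← integral_sub (hint F y) (hint g y)]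
    refine (norm_integral_le_of_norm_le_const (C := 1 / 4) (ae_of_all _ fun l => ?_)).trans
      (by simp)
    rw [← dist_eq_norm]
    exact (ContinuousMap.dist_apply_le_dist _).trans hFg.le
  have h0 : ∫ l : L, F (0 + l) ∂μ = 0 := by
    have (l : L) : F (0 + l) = 0 := by simp [F, hf0 l.2]
    simp only [this, integral_zero]
  have h1 : ∫ l : L, F (x + l) ∂μ = 1 := by
    have (l : L) : F (x + l) = 1 := by simp [F, hf1 ⟨l, l.2, rfl⟩]
    simp [this]
  have e0 := hclose 0
  have e1 := hclose x
  rw [h0, hspan g hg, zero_sub, norm_neg] at e0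
  rw [h1] at e1
  have := norm_sub_norm_le (1 : ℂ) (∫ l : L, g (x + l) ∂μ)
  rw [norm_one] at this
  linarith

/-- A complex number all of whose powers lie within `1 / 2` of `1` is equal to `1`. -/
theorem Complex.eq_one_of_forall_norm_pow_sub_one_lt {z : ℂ}
    (hz : ∀ k : ℕ, ‖z ^ k - 1‖ < 1 / 2) : z = 1 := by
  have hgrow (k : ℕ) : (3 / 2 : ℝ) ^ k * ‖z - 1‖ ≤ ‖z ^ 2 ^ k - 1‖ := by
    induction k with
    | zero => simp
    | succ k ih =>
      have hfac : z ^ 2 ^ (k + 1) - 1 = (z ^ 2 ^ k + 1) * (z ^ 2 ^ k - 1) := by ring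
      have h2 : 3 / 2 ≤ ‖z ^ 2 ^ k + 1‖ := by
        have := norm_sub_norm_le (2 : ℂ) (1 - z ^ 2 ^ k)
        rw [norm_sub_rev 1, show (2 : ℂ) - (1 - z ^ 2 ^ k) = z ^ 2 ^ k + 1 by ring,
          Complex.norm_ofNat] at this
        linarith [hz (2 ^ k)]
      rw [hfac, norm_mul, pow_succ', mul_assoc]
      gcongr
  by_contra hne
  have hpos : 0 < ‖z - 1‖ := norm_pos_iff.mpr (sub_ne_zero.mpr hne)
  obtain ⟨k, hk⟩ := pow_unbounded_of_one_lt (1 / 2 / ‖z - 1‖) (by norm_num : (1 : ℝ) < 3 / 2)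
  rw [div_lt_iff₀ hpos] at hk
  linarith [hgrow k, hz (2 ^ k)]

/-- A torus modulo a closed subgroup has no small subgroups. -/
theorem UnitAddTorus.exists_isOpen_forall_addSubgroup_le {ι : Type*} [Fintype ι]
    {L : AddSubgroup (UnitAddTorus ι)} (hL : IsClosed (L : Set (UnitAddTorus ι))) :
    ∃ V : Set (UnitAddTorus ι), IsOpen V ∧ (L : Set (UnitAddTorus ι)) ⊆ V ∧
      ∀ H : AddSubgroup (UnitAddTorus ι), (H : Set (UnitAddTorus ι)) ⊆ V → H ≤ L := by
  have hzero (n : ι → ℤ) : mFourier n (0 : UnitAddTorus ι) = 1 := by simp [mFourier]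
  let N : Submodule ℤ (ι → ℤ) := AddSubgroup.toIntSubmodule
    { carrier := {n | ∀ l ∈ L, mFourier n l = 1}
      zero_mem' := fun l _ => by simp [mFourier_zero]
      add_mem' := fun {m n} hm hn l hl => by simp [mFourier_add, hm l hl, hn l hl]
      neg_mem' := fun {n} hn l hl => by simp [mFourier_neg, hn l hl] }
  obtain ⟨s, hs⟩ := IsNoetherian.noetherian N
  refine ⟨⋂ n ∈ s, {y | ‖mFourier n y - 1‖ < 1 / 2}, ?_, ?_, ?_⟩
  · exact isOpen_biInter_finset fun n _ =>
      isOpen_lt (by fun_prop) continuous_const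
  · intro l hl
    simp only [Set.mem_iInter, Set.mem_ofPred_eq]
    intro n hn
    have : n ∈ N := hs ▸ Submodule.subset_span hn
    simp [show mFourier n l = 1 from this l hl]
  · intro H hH x hx
    by_contra hxL
    obtain ⟨n, hn, hnx⟩ := exists_mFourier_ne_one_of_notMem hL hxL
    refine hnx ?_
    have hnN : n ∈ Submodule.span ℤ (s : Set (ι → ℤ)) := hs ▸ hn
    let K : Submodule ℤ (ι → ℤ) := AddSubgroup.toIntSubmodule
      { carrier := {n | mFourier n x = 1}
        zero_mem' := by simp [mFourier_zero]
        add_mem' := fun {m n} (hm : _ = _) (hn : _ = _) => by simp [mFourier_add, hm, hn]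
        neg_mem' := fun {n} (hn : _ = _) => by simp [mFourier_neg, hn] }
    refine (Submodule.span_le (p := K)).mpr (fun m hm => ?_) hnN
    refine Complex.eq_one_of_forall_norm_pow_sub_one_lt fun k => ?_
    have hpow : mFourier m (k • x) = mFourier m x ^ k := by
      induction k with
      | zero => simp [hzero]
      | succ k ih => rw [succ_nsmul, mFourier_apply_add, ih, pow_succ]
    rw [← hpow]
    exact Set.mem_iInter₂.mp (hH (H.nsmul_mem hx k)) m hm

open Filter Topology in
/-- The Kuratowski lower limit of subgroups along a filter. -/
def AddSubgroup.lowerLimit {G : Type*} [AddGroup G] [TopologicalSpace G] [IsTopologicalAddGroup G]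
    (F : Filter (AddSubgroup G)) : AddSubgroup G where
  carrier := {x | ∀ V ∈ 𝓝 x, ∀ᶠ H in F, ∃ y ∈ H, y ∈ V}
  zero_mem' V hV := .of_forall fun H => ⟨0, H.zero_mem, mem_of_mem_nhds hV⟩
  add_mem' {x y} hx hy V hV := by
    obtain ⟨A, hA, B, hB, hAB⟩ := mem_nhds_prod_iff.mp (continuous_add.tendsto (x, y) hV)
    filter_upwards [hx A hA, hy B hB] with H ⟨a, ha, haA⟩ ⟨b, hb, hbB⟩
    exact ⟨a + b, H.add_mem ha hb, hAB (Set.mk_mem_prod haA hbB)⟩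
  neg_mem' {x} hx V hV := by
    filter_upwards [hx _ (continuous_neg.tendsto x hV)] with H ⟨a, ha, haV⟩
    exact ⟨-a, H.neg_mem ha, haV⟩

namespace AddSubgroup

open Filter Topology

variable {G : Type*} [AddGroup G] [TopologicalSpace G] [IsTopologicalAddGroup G]

theorem isClosed_lowerLimit (F : Filter (AddSubgroup G)) :
    IsClosed (lowerLimit F : Set G) := by
  refine isClosed_of_closure_subset fun x hx V hV => ?_
  obtain ⟨W, hWV, hW, hxW⟩ := mem_nhds_iff.mp hV
  obtain ⟨y, hyW, hy⟩ := mem_closure_iff.mp hx W hW hxW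
  filter_upwards [hy W (hW.mem_nhds hyW)] with H ⟨a, ha, haW⟩
  exact ⟨a, ha, hWV haW⟩

/-- In a compact group, subgroups are eventually contained in every neighbourhood of their limit
along an ultrafilter. -/
theorem eventually_subset_of_lowerLimit_subset [CompactSpace G] (F : Ultrafilter (AddSubgroup G))
    {V : Set G} (hV : IsOpen V) (hFV : (lowerLimit (F : Filter (AddSubgroup G)) : Set G) ⊆ V) :
    ∀ᶠ H : AddSubgroup G in F, (H : Set G) ⊆ V := by
  have hcompl : ∀ᶠ H : AddSubgroup G in F, Disjoint (H : Set G) Vᶜ := by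
    refine hV.isClosed_compl.isCompact.induction_on
      (p := fun A => ∀ᶠ H : AddSubgroup G in F, Disjoint (H : Set G) A)
      (by simp) (fun A B hAB hB => hB.mono fun H h => h.mono_right hAB)
      (fun A B hA hB => (hA.and hB).mono fun H h => Set.disjoint_union_right.mpr h) ?_
    intro x hx
    have hxL : ¬ ∀ W ∈ 𝓝 x, ∀ᶠ H in (F : Filter (AddSubgroup G)), ∃ y ∈ H, y ∈ W :=
      fun h => hx (hFV h)
    push Not at hxL
    obtain ⟨W, hW, h⟩ := hxL
    refine ⟨W, mem_nhdsWithin_of_mem_nhds hW, ?_⟩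
    exact h.mono fun H hH => Set.disjoint_left.mpr hH
  exact hcompl.mono fun H h => Set.disjoint_compl_right_iff_subset.mp h

end AddSubgroup

/-- **Lawrence's theorem.** Let `T = (ℝ/ℤ)^d` be the `d`-dimensional torus
and `U ⊆ T` an open set.  Among all closed additive subgroups of `T`
disjoint from `U`, the maximal ones (with respect to inclusion) form a
finite set. -/
theorem lawrence_finitely_many_maximal_subgroups (d : ℕ)
    (U : Set (Fin d → AddCircle (1 : ℝ))) (hU : IsOpen U) :
    {L : AddSubgroup (Fin d → AddCircle (1 : ℝ)) |
        (IsClosed (L : Set (Fin d → AddCircle (1 : ℝ))) ∧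
          (L : Set (Fin d → AddCircle (1 : ℝ))) ∩ U = ∅) ∧
        ∀ L' : AddSubgroup (Fin d → AddCircle (1 : ℝ)),
          (IsClosed (L' : Set (Fin d → AddCircle (1 : ℝ))) ∧
            (L' : Set (Fin d → AddCircle (1 : ℝ))) ∩ U = ∅) →
          L ≤ L' → L' = L}.Finite := by
  refine Set.not_infinite.mp fun hS => ?_
  obtain ⟨F, hF⟩ := @Ultrafilter.exists_le _ _ hS.cofinite_inf_principal_neBot
  have hmem := Filter.le_principal_iff.mp (hF.trans inf_le_right)
  let L := AddSubgroup.lowerLimit (F : Filter (AddSubgroup (Fin d → AddCircle (1 : ℝ))))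
  have hL : IsClosed (L : Set (Fin d → AddCircle (1 : ℝ))) := AddSubgroup.isClosed_lowerLimit _
  have hLU : (L : Set (Fin d → AddCircle (1 : ℝ))) ∩ U = ∅ := by
    refine Set.eq_empty_iff_forall_notMem.mpr fun x ⟨hxL, hxU⟩ => ?_
    obtain ⟨H, ⟨y, hyH, hyU⟩, hH⟩ := ((hxL U (hU.mem_nhds hxU)).and hmem).exists
    exact Set.eq_empty_iff_forall_notMem.mp hH.1.2 y ⟨hyH, hyU⟩
  obtain ⟨V, hV, hLV, hsmall⟩ := UnitAddTorus.exists_isOpen_forall_addSubgroup_le hL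
  have hev := AddSubgroup.eventually_subset_of_lowerLimit_subset F hV hLV
  have hne : ∀ᶠ H in (F : Filter _), H ≠ L :=
    (hF.trans inf_le_left) (Set.finite_singleton L).compl_mem_cofinite
  obtain ⟨H, ⟨hHV, hH⟩, hHL⟩ := ((hev.and hmem).and hne).exists
  exact hHL (hH.2 L ⟨hL, hLU⟩ (hsmall H hHV)).symm
end

section
/- (Nyman–Beurling criterion) The Riemann Hypothesis holds if and only if the linear span of the family of functions ρ_α(x) = {α/x} − α·{1/x}, for 0 < α < 1, is dense in the Hilbert space L²((0,1)) of square-integrable real functions on the unit interval with respect to Lebesgue measure. -/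
open MeasureTheory

section NymanBeurling

open Set Filter Topology

/-- A function of the form `z ↦ ∫ f(t) t ^ z dt` is complex differentiable at each interior point
of its strip of absolute convergence. -/
theorem differentiableAt_integral_mul_cpow {f : ℝ → ℂ} {s : ℂ} {ε : ℝ} (hε : 0 < ε)
    (hf : AEStronglyMeasurable f (volume.restrict (Ioi 0)))
    (h₁ : IntegrableOn (fun t : ℝ => ‖f t‖ * t ^ (s.re - 2 * ε)) (Ioi 0))
    (h₂ : IntegrableOn (fun t : ℝ => ‖f t‖ * t ^ (s.re + 2 * ε)) (Ioi 0)) :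
    DifferentiableAt ℂ (fun z : ℂ => ∫ t in Ioi (0 : ℝ), f t * (t : ℂ) ^ z) s := by
  have hmeas (z : ℂ) : AEStronglyMeasurable (fun t : ℝ => f t * (t : ℂ) ^ z)
      (volume.restrict (Ioi 0)) := by
    refine hf.mul (ContinuousOn.aestronglyMeasurable (fun t ht => ?_) measurableSet_Ioi)
    exact (Complex.continuousAt_ofReal_cpow_const _ _ (Or.inr ht.ne')).continuousWithinAt
  refine (hasDerivAt_integral_of_dominated_loc_of_deriv_le
    (F' := fun (z : ℂ) (t : ℝ) => f t * ((t : ℂ) ^ z * Complex.log t))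
    (bound := fun t : ℝ => (‖f t‖ * t ^ (s.re - 2 * ε) + ‖f t‖ * t ^ (s.re + 2 * ε)) / ε)
    (Metric.ball_mem_nhds s hε) (Eventually.of_forall hmeas) ?_ ?_ ?_ ?_ ?_).2.differentiableAt
  · refine Integrable.mono' (h₁.add h₂) (hmeas s) ?_
    refine (ae_restrict_iff' measurableSet_Ioi).2 (Eventually.of_forall fun t ht => ?_)
    have ht : 0 < t := ht
    simp only [Pi.add_apply]
    rw [norm_mul, Complex.norm_cpow_eq_rpow_re_of_pos ht, ← mul_add]
    refine mul_le_mul_of_nonneg_left ?_ (norm_nonneg _)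
    rcases le_total 1 t with h | h
    · have := Real.rpow_le_rpow_of_exponent_le h (show s.re ≤ s.re + 2 * ε by linarith)
      have := Real.rpow_nonneg ht.le (s.re - 2 * ε)
      linarith
    · have := Real.rpow_le_rpow_of_exponent_ge ht h (show s.re - 2 * ε ≤ s.re by linarith)
      have := Real.rpow_nonneg ht.le (s.re + 2 * ε)
      linarith
  · refine hf.mul (ContinuousOn.aestronglyMeasurable (fun t ht => ?_) measurableSet_Ioi)
    refine (ContinuousAt.mul (Complex.continuousAt_ofReal_cpow_const _ _ (Or.inr ht.ne'))
      ?_).continuousWithinAt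
    exact (Complex.continuous_ofReal.continuousAt).clog (Complex.ofReal_mem_slitPlane.2 ht)
  · refine (ae_restrict_iff' measurableSet_Ioi).2 (Eventually.of_forall fun t ht z hz => ?_)
    have ht : 0 < t := ht
    rw [norm_mul, norm_mul, Complex.norm_cpow_eq_rpow_re_of_pos ht, ← mul_add, mul_div_assoc,
      ← Complex.ofReal_log ht.le, Complex.norm_real, Real.norm_eq_abs]
    refine mul_le_mul_of_nonneg_left ?_ (norm_nonneg _)
    have hz' : |z.re - s.re| < ε := by
      refine lt_of_le_of_lt ?_ (mem_ball_iff_norm.1 hz)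
      simpa using Complex.abs_re_le_norm (z - s)
    rw [abs_lt] at hz'
    rw [le_div_iff₀ hε]
    rcases le_total 1 t with h | h
    · have h3 := Real.rpow_le_rpow_of_exponent_le h (show z.re ≤ s.re + ε by linarith)
      have h4 : |Real.log t| * ε ≤ t ^ ε := by
        rw [abs_of_nonneg (Real.log_nonneg h), ← le_div_iff₀ hε]
        exact Real.log_le_rpow_div ht.le hε
      have h5 : t ^ (s.re + 2 * ε) = t ^ (s.re + ε) * t ^ ε := by
        rw [← Real.rpow_add ht]; ring_nf
      have := Real.rpow_nonneg ht.le (s.re - 2 * ε)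
      rw [mul_assoc, h5]
      have := mul_le_mul h3 h4 (by positivity) (by positivity)
      linarith
    · have h3 := Real.rpow_le_rpow_of_exponent_ge ht h (show s.re - ε ≤ z.re by linarith)
      have h4 : |Real.log t| * ε ≤ t ^ (-ε) := by
        rw [abs_of_nonpos (Real.log_nonpos ht.le h), ← le_div_iff₀ hε, ← Real.log_inv,
          Real.rpow_neg ht.le, ← Real.inv_rpow ht.le]
        exact Real.log_le_rpow_div (inv_nonneg.2 ht.le) hε
      have h5 : t ^ (s.re - 2 * ε) = t ^ (s.re - ε) * t ^ (-ε) := by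
        rw [← Real.rpow_add ht]; ring_nf
      have := Real.rpow_nonneg ht.le (s.re + 2 * ε)
      rw [mul_assoc, h5]
      have := mul_le_mul h3 h4 (by positivity) (by positivity)
      linarith
  · exact (h₁.add h₂).div_const ε
  · refine (ae_restrict_iff' measurableSet_Ioi).2 (Eventually.of_forall fun t ht z hz => ?_)
    have ht : (t : ℂ) ≠ 0 := Complex.ofReal_ne_zero.2 (ne_of_gt ht)
    have := (hasDerivAt_id z).const_cpow (c := (t : ℂ)) (Or.inl ht)
    simpa using this.const_mul (f t)

/-- The Mellin-type transform `∫_1^∞ G(t) t ^ (-s-1) dt`. -/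
noncomputable def tailMellin (G : ℝ → ℂ) (s : ℂ) : ℂ :=
  ∫ t in Ioi (1 : ℝ), G t * (t : ℂ) ^ (-(s + 1))

section tailMellin

variable {G : ℝ → ℂ} {C : ℝ} {s : ℂ}

theorem norm_mul_cpow_le (hG : ∀ t, ‖G t‖ ≤ C) (t : ℝ) (ht : t ∈ Ioi (1 : ℝ)) :
    ‖G t * (t : ℂ) ^ (-(s + 1))‖ ≤ C * t ^ (-(s.re + 1)) := by
  have ht : 1 < t := ht
  rw [norm_mul, Complex.norm_cpow_eq_rpow_re_of_pos (by linarith)]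
  simpa using mul_le_mul_of_nonneg_right (hG t) (Real.rpow_nonneg (by linarith) _)

theorem norm_tailMellin_le (hG : ∀ t, ‖G t‖ ≤ C) (hs : 0 < s.re) :
    ‖tailMellin G s‖ ≤ C / s.re := by
  have hi : IntegrableOn (fun t : ℝ => C * t ^ (-(s.re + 1))) (Ioi 1) :=
    (integrableOn_Ioi_rpow_of_lt (by linarith) one_pos).const_mul C
  refine (norm_integral_le_of_norm_le hi ((ae_restrict_iff' measurableSet_Ioi).2
    (Eventually.of_forall (norm_mul_cpow_le hG)))).trans ?_
  rw [integral_const_mul, integral_Ioi_rpow_of_lt (by linarith) one_pos]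
  refine le_of_eq ?_
  simp only [Real.one_rpow]
  have : s.re ≠ 0 := hs.ne'
  rw [show -(s.re + 1) + 1 = - s.re by ring]
  field_simp

theorem integrableOn_mul_cpow (hm : Measurable G) (hG : ∀ t, ‖G t‖ ≤ C) (hs : 0 < s.re) :
    IntegrableOn (fun t : ℝ => G t * (t : ℂ) ^ (-(s + 1))) (Ioi 1) := by
  have hi : IntegrableOn (fun t : ℝ => C * t ^ (-(s.re + 1))) (Ioi 1) :=
    (integrableOn_Ioi_rpow_of_lt (by linarith) one_pos).const_mul C
  exact hi.mono' (by fun_prop) ((ae_restrict_iff' measurableSet_Ioi).2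
    (Eventually.of_forall (norm_mul_cpow_le hG)))

theorem differentiableAt_tailMellin (hm : Measurable G) (hG : ∀ t, ‖G t‖ ≤ C) (hs : 0 < s.re) :
    DifferentiableAt ℂ (tailMellin G) s := by
  have key (x : ℝ) (hx : x < -1) :
      IntegrableOn (fun t : ℝ => ‖(Ioi (1 : ℝ)).indicator G t‖ * t ^ x) (Ioi 0) := by
    have : (fun t : ℝ => ‖(Ioi (1 : ℝ)).indicator G t‖ * t ^ x)
        = (Ioi (1 : ℝ)).indicator (fun t => ‖G t‖ * t ^ x) := by
      ext t
      by_cases ht : t ∈ Ioi (1 : ℝ) <;> simp [ht]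
    rw [this]
    refine (IntegrableOn.integrable_indicator ?_ measurableSet_Ioi).integrableOn
    refine ((integrableOn_Ioi_rpow_of_lt hx one_pos).const_mul C).mono' (by fun_prop) ?_
    refine (ae_restrict_iff' measurableSet_Ioi).2 (Eventually.of_forall fun t ht => ?_)
    have ht : (0 : ℝ) < t := one_pos.trans ht
    rw [norm_mul, norm_norm, Real.norm_of_nonneg (Real.rpow_nonneg ht.le _)]
    exact mul_le_mul_of_nonneg_right (hG t) (Real.rpow_nonneg ht.le _)
  have h := differentiableAt_integral_mul_cpow (f := (Ioi (1 : ℝ)).indicator G)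
    (s := -(s + 1)) (ε := s.re / 4) (by linarith)
    (hm.indicator measurableSet_Ioi).aestronglyMeasurable
    (key _ (by simp; linarith)) (key _ (by simp; linarith))
  have heq : tailMellin G = (fun z : ℂ => ∫ t in Ioi (0 : ℝ),
      (Ioi (1 : ℝ)).indicator G t * (t : ℂ) ^ z) ∘ fun s => -(s + 1) := by
    ext z
    have : (fun t : ℝ => (Ioi (1 : ℝ)).indicator G t * (t : ℂ) ^ (-(z + 1)))
        = (Ioi (1 : ℝ)).indicator fun t : ℝ => G t * (t : ℂ) ^ (-(z + 1)) := by
      ext t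
      by_cases ht : t ∈ Ioi (1 : ℝ) <;> simp [ht]
    simp only [Function.comp, tailMellin]
    rw [this, setIntegral_indicator measurableSet_Ioi,
      Set.inter_eq_right.2 (Ioi_subset_Ioi zero_le_one)]
  rw [heq]
  exact h.comp s (by fun_prop)

end tailMellin

theorem norm_ofReal_fract_le (t : ℝ) : ‖((Int.fract t : ℝ) : ℂ)‖ ≤ 1 := by
  rw [Complex.norm_real, Real.norm_of_nonneg (Int.fract_nonneg t)]
  exact (Int.fract_lt_one t).le

theorem measurable_ofReal_fract : Measurable fun t : ℝ => ((Int.fract t : ℝ) : ℂ) :=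
  Complex.measurable_ofReal.comp measurable_fract

theorem sub_one_mul_riemannZeta_of_one_lt_re {s : ℂ} (hs : 1 < s.re) :
    (s - 1) * riemannZeta s =
      s - s * (s - 1) * tailMellin (fun t => ((Int.fract t : ℝ) : ℂ)) s := by
  have hs1 : s - 1 ≠ 0 := fun h => by
    rw [sub_eq_zero] at h; simp [h] at hs
  have h := LSeries_eq_mul_integral_of_nonneg (fun _ => 1) zero_le_one (s := s) (by simpa using hs)
    (by
      refine Asymptotics.IsBigO.of_bound 1 (Eventually.of_forall fun n => ?_)
      simp) (fun _ => zero_le_one)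
  have h1 : LSeries (fun n => ((1 : ℝ) : ℂ)) s = riemannZeta s := by
    simpa using! LSeries_one_eq_riemannZeta hs
  have hi1 := integrableOn_mul_cpow measurable_ofReal_fract norm_ofReal_fract_le
    (s := s) (by linarith)
  have hi2 : IntegrableOn (fun t : ℝ => (t : ℂ) ^ (-s)) (Ioi 1) :=
    integrableOn_Ioi_cpow_of_lt (by simpa using hs) one_pos
  have h2 : ∫ t in Ioi (1 : ℝ), (∑ k ∈ Finset.Icc 1 ⌊t⌋₊, ((1 : ℝ) : ℂ)) * (t : ℂ) ^ (-(s + 1))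
      = ∫ t in Ioi (1 : ℝ), ((t : ℂ) ^ (-s)
        - ((Int.fract t : ℝ) : ℂ) * (t : ℂ) ^ (-(s + 1))) := by
    refine setIntegral_congr_fun measurableSet_Ioi fun t ht => ?_
    have ht : 1 < t := ht
    have ht0 : (t : ℂ) ≠ 0 := Complex.ofReal_ne_zero.2 (by linarith)
    have hfl : (⌊t⌋₊ : ℝ) = t - Int.fract t := by
      rw [natCast_floor_eq_intCast_floor (by linarith), Int.self_sub_fract]
    have hfl : (⌊t⌋₊ : ℂ) = t - (Int.fract t : ℝ) := by exact_mod_cast congrArg Complex.ofReal hfl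
    have : (t : ℂ) ^ (-s) = t * (t : ℂ) ^ (-(s + 1)) := by
      rw [show -s = 1 + -(s + 1) by ring, Complex.cpow_add _ _ ht0, Complex.cpow_one]
    simp only [Complex.ofReal_one, Finset.sum_const, Nat.card_Icc, add_tsub_cancel_right,
      nsmul_eq_mul, mul_one, hfl, this]
    ring
  rw [h1, h2, integral_sub hi2 hi1,
    integral_Ioi_cpow_of_lt (by simpa using hs) one_pos] at h
  rw [h, tailMellin]
  simp only [Complex.ofReal_one, Complex.one_cpow]
  have : -s + 1 ≠ 0 := fun h => hs1 (by linear_combination -h)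
  field_simp
  ring

/-- Analytic continuation of the integral representation of `(s - 1) ζ(s)` to `0 < Re s`. -/
theorem sub_one_mul_riemannZeta {s : ℂ} (hs : 0 < s.re) (hs1 : s ≠ 1) :
    (s - 1) * riemannZeta s =
      s - s * (s - 1) * tailMellin (fun t => ((Int.fract t : ℝ) : ℂ)) s := by
  set ζ₁ : ℂ → ℂ := Function.update (fun s => (s - 1) * riemannZeta s) 1 1
  set U : Set ℂ := {z | 0 < z.re}
  have hUo : IsOpen U := isOpen_lt continuous_const Complex.continuous_re
  have hUc : IsPreconnected U := (convex_halfSpace_re_gt 0).isPreconnected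
  have hd : ∀ z ≠ (1 : ℂ), DifferentiableAt ℂ (fun s => (s - 1) * riemannZeta s) z := fun z hz =>
    (by fun_prop : DifferentiableAt ℂ (fun s : ℂ => s - 1) z).mul (differentiableAt_riemannZeta hz)
  have h₁ : AnalyticOnNhd ℂ ζ₁ U := by
    refine DifferentiableOn.analyticOnNhd
      (fun z _ => DifferentiableAt.differentiableWithinAt ?_) hUo
    rcases eq_or_ne z 1 with rfl | hz
    · refine (Complex.analyticAt_of_differentiable_on_punctured_nhds_of_continuousAt ?_
        (continuousAt_update_same.2 riemannZeta_residue_one)).differentiableAt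
      filter_upwards [self_mem_nhdsWithin] with z hz
      refine (hd z hz).congr_of_eventuallyEq ?_
      filter_upwards [isOpen_ne.mem_nhds hz] with w hw
      exact Function.update_of_ne hw _ _
    · refine (hd z hz).congr_of_eventuallyEq ?_
      filter_upwards [isOpen_ne.mem_nhds hz] with w hw
      exact Function.update_of_ne hw _ _
  have h₂ : AnalyticOnNhd ℂ
      (fun s => s - s * (s - 1) * tailMellin (fun t => ((Int.fract t : ℝ) : ℂ)) s) U := by
    refine DifferentiableOn.analyticOnNhd
      (fun z hz => DifferentiableAt.differentiableWithinAt ?_) hUo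
    have := differentiableAt_tailMellin measurable_ofReal_fract norm_ofReal_fract_le hz
    fun_prop
  have heq := h₁.eqOn_of_preconnected_of_eventuallyEq h₂ hUc (z₀ := 2) (by simp [U]) (by
    have : {z : ℂ | 1 < z.re} ∈ 𝓝 (2 : ℂ) :=
      (isOpen_lt continuous_const Complex.continuous_re).mem_nhds (by simp)
    filter_upwards [this] with z hz
    have hz1 : z ≠ 1 := by rintro rfl; simp at hz
    simp only [ζ₁, Function.update_of_ne hz1]
    exact sub_one_mul_riemannZeta_of_one_lt_re hz) hs
  simpa only [ζ₁, Function.update_of_ne hs1] using heq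

theorem mellinConvergent_fract {s : ℂ} (h0 : 0 < s.re) (h1 : s.re < 1) :
    MellinConvergent (fun t : ℝ => ((Int.fract t : ℝ) : ℂ)) (-s) ∧
    mellin (fun t : ℝ => ((Int.fract t : ℝ) : ℂ)) (-s) = -riemannZeta s / s := by
  have hs0 : s ≠ 0 := by rintro rfl; simp at h0
  have hs1 : s - 1 ≠ 0 := sub_ne_zero.2 (by rintro rfl; simp at h1)
  have hs1' : 1 - s ≠ 0 := sub_ne_zero.2 (by rintro rfl; simp at h1)
  have e1 : EqOn (fun t : ℝ => (t : ℂ) ^ (-s - 1) • ((Int.fract t : ℝ) : ℂ))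
      (fun t : ℝ => ((Int.fract t : ℝ) : ℂ) * (t : ℂ) ^ (-(s + 1))) (Ioi 1) := fun t ht => by
    simp only [smul_eq_mul]
    rw [mul_comm, show -s - 1 = -(s + 1) by ring]
  have e2 : (fun t : ℝ => (t : ℂ) ^ (-s - 1) • ((Int.fract t : ℝ) : ℂ))
      =ᵐ[volume.restrict (Ioc 0 1)] fun t : ℝ => (t : ℂ) ^ (-s) := by
    refine (ae_restrict_iff' measurableSet_Ioc).2 ?_
    filter_upwards [compl_mem_ae_iff.2 (measure_singleton (1 : ℝ))] with t ht1 ht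
    have ht1 : t < 1 := lt_of_le_of_ne ht.2 ht1
    have ht0 : (t : ℂ) ≠ 0 := Complex.ofReal_ne_zero.2 ht.1.ne'
    rw [Int.fract_eq_self.2 ⟨ht.1.le, ht1⟩, smul_eq_mul, Complex.cpow_sub _ _ ht0,
      Complex.cpow_one, div_mul_cancel₀ _ ht0]
  have i1 : IntegrableOn (fun t : ℝ => (t : ℂ) ^ (-s - 1) • ((Int.fract t : ℝ) : ℂ)) (Ioi 1) :=
    (integrableOn_mul_cpow measurable_ofReal_fract norm_ofReal_fract_le h0).congr_fun
      (fun t ht => (e1 ht).symm) measurableSet_Ioi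
  have i2' : IntervalIntegrable (fun t : ℝ => (t : ℂ) ^ (-s)) volume 0 1 :=
    intervalIntegral.intervalIntegrable_cpow' (by simpa using h1)
  have i2 : IntegrableOn (fun t : ℝ => (t : ℂ) ^ (-s - 1) • ((Int.fract t : ℝ) : ℂ)) (Ioc 0 1) :=
    ((intervalIntegrable_iff_integrableOn_Ioc_of_le zero_le_one).1 i2').congr e2.symm
  constructor
  · rw [MellinConvergent, ← Ioc_union_Ioi_eq_Ioi zero_le_one]
    exact i2.union i1
  · rw [mellin, ← Ioc_union_Ioi_eq_Ioi zero_le_one,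
      setIntegral_union Ioc_disjoint_Ioi_same measurableSet_Ioi i2 i1,
      integral_congr_ae e2, setIntegral_congr_fun measurableSet_Ioi e1,
      ← intervalIntegral.integral_of_le zero_le_one,
      integral_cpow (Or.inl (by simpa using h1))]
    have h := sub_one_mul_riemannZeta h0 (sub_ne_zero.1 hs1)
    rw [tailMellin] at h
    have hne : -s + 1 ≠ 0 := by rwa [neg_add_eq_sub]
    simp only [Complex.ofReal_one, Complex.one_cpow, Complex.ofReal_zero, Complex.zero_cpow hne]
    have h' : riemannZeta s = (s - s * (s - 1) * ∫ t in Ioi (1 : ℝ),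
        ((Int.fract t : ℝ) : ℂ) * (t : ℂ) ^ (-(s + 1))) / (s - 1) := by
      rw [eq_div_iff hs1, ← h]; ring
    rw [h']
    field_simp
    ring

/-- Lower bound for a nonvanishing holomorphic function on a disc in terms of its maximum, by the
Borel–Carathéodory theorem applied to its logarithm. -/
theorem norm_center_le_mul_exp {f : ℂ → ℂ} {c z : ℂ} {R B : ℝ} (hR : 0 < R) (hB : 1 < B)
    (hf : DifferentiableOn ℂ f (Metric.ball c R)) (h0 : ∀ w ∈ Metric.ball c R, f w ≠ 0)
    (hfB : ∀ w ∈ Metric.ball c R, ‖f w‖ ≤ B * ‖f c‖) (hz : z ∈ Metric.ball c R) :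
    ‖f c‖ ≤ ‖f z‖ * Real.exp (2 * Real.log B * ‖z - c‖ / (R - ‖z - c‖)) := by
  have hc : c ∈ Metric.ball c R := Metric.mem_ball_self hR
  have hfc : 0 < ‖f c‖ := norm_pos_iff.2 (h0 c hc)
  have hdf : ∀ w ∈ Metric.ball c R, HasDerivAt f (deriv f w) w := fun w hw =>
    (hf.differentiableAt (Metric.isOpen_ball.mem_nhds hw)).hasDerivAt
  obtain ⟨L, hLc, hL⟩ := ((hf.deriv Metric.isOpen_ball).div hf h0).isExactOn_ball.with_val_at c 0
  have hexp : ∀ w ∈ Metric.ball c R, f w = f c * Complex.exp (L w) := by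
    intro w hw
    have hd : ∀ w ∈ Metric.ball c R, HasDerivAt (fun w => f w * Complex.exp (-L w)) 0 w := by
      intro w hw
      have h1 : HasDerivAt (fun w => f w * Complex.exp (-L w)) _ w :=
        (hdf w hw).mul (hL w hw).neg.cexp
      have h2 : f w ≠ 0 := h0 w hw
      refine h1.congr_deriv ?_
      simp only [Pi.div_apply, Pi.neg_apply]
      field_simp
      ring
    have hconst := (convex_ball c R).is_const_of_fderivWithin_eq_zero (𝕜 := ℂ)
      (fun w hw => (hd w hw).differentiableAt.differentiableWithinAt)
      (fun w hw => by
        rw [fderivWithin_of_isOpen Metric.isOpen_ball hw]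
        simpa using (hd w hw).hasFDerivAt.fderiv) hw hc
    simp only [hLc, neg_zero, Complex.exp_zero, mul_one] at hconst
    rw [← hconst, mul_assoc, ← Complex.exp_add, neg_add_cancel, Complex.exp_zero, mul_one]
  have hre : ∀ w ∈ Metric.ball c R, (L w).re ≤ Real.log B := by
    intro w hw
    rw [Real.le_log_iff_exp_le (by linarith), ← Complex.norm_exp]
    have := hfB w hw
    rw [hexp w hw, norm_mul, mul_comm] at this
    exact le_of_mul_le_mul_right this hfc
  have hmem : ∀ w ∈ Metric.ball (0 : ℂ) R, c + w ∈ Metric.ball c R := fun w hw => by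
    simpa [dist_eq_norm] using hw
  have hbc := Complex.borelCaratheodory_zero (f := fun w => L (c + w)) (z := z - c)
    (Real.log_pos hB)
    (fun w hw => ((hL _ (hmem w hw)).comp_const_add c w).differentiableAt.differentiableWithinAt)
    (fun w hw => hre _ (hmem w hw)) hR (by simpa [dist_eq_norm] using hz) (by simpa using hLc)
  simp only [add_sub_cancel] at hbc
  rw [hexp z hz, norm_mul, Complex.norm_exp, mul_assoc, ← Real.exp_add]
  refine le_mul_of_one_le_right (norm_nonneg _) (Real.one_le_exp ?_)
  have := (abs_le.1 (Complex.abs_re_le_norm (L z))).1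
  linarith

/-- The meromorphic function `c / (1 - s) + ∫_{1}^∞ G(t) t^{-(s+1)} dt`, multiplied by
`-s (s - 1)`. -/
noncomputable def polarTailMellin (c : ℂ) (G : ℝ → ℂ) (s : ℂ) : ℂ :=
  s * c - s * (s - 1) * tailMellin G s

theorem differentiableAt_polarTailMellin {c : ℂ} {G : ℝ → ℂ} {C : ℝ} {s : ℂ} (hm : Measurable G)
    (hG : ∀ t, ‖G t‖ ≤ C) (hs : 0 < s.re) : DifferentiableAt ℂ (polarTailMellin c G) s := by
  have := differentiableAt_tailMellin hm hG hs
  unfold polarTailMellin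
  fun_prop

theorem norm_polarTailMellin_le {c : ℂ} {G : ℝ → ℂ} {C : ℝ} {s : ℂ}
    (hG : ∀ t, ‖G t‖ ≤ C) (hs : 0 < s.re) :
    ‖polarTailMellin c G s‖ ≤ ‖s‖ * ‖c‖ + ‖s‖ * ‖s - 1‖ * (C / s.re) := by
  refine (norm_sub_le _ _).trans ?_
  rw [norm_mul, norm_mul, norm_mul]
  gcongr
  exact norm_tailMellin_le hG hs

/-- The function `(s - 1) ζ(s)`, continued to `s = 1`, on the half-plane `0 < Re s`. -/
noncomputable def regZeta : ℂ → ℂ := polarTailMellin 1 fun t => ((Int.fract t : ℝ) : ℂ)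

theorem differentiableAt_regZeta {s : ℂ} (hs : 0 < s.re) : DifferentiableAt ℂ regZeta s :=
  differentiableAt_polarTailMellin measurable_ofReal_fract norm_ofReal_fract_le hs

theorem regZeta_eq {s : ℂ} (hs : 0 < s.re) (hs1 : s ≠ 1) :
    regZeta s = (s - 1) * riemannZeta s := by
  rw [sub_one_mul_riemannZeta hs hs1, regZeta, polarTailMellin, mul_one]

theorem regZeta_one : regZeta 1 = 1 := by simp [regZeta, polarTailMellin]

theorem quarter_le_norm_riemannZeta {s : ℂ} (hs : 2 ≤ s.re) : 1 / 4 ≤ ‖riemannZeta s‖ := by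
  have hterm : ∀ n : ℕ, ‖1 / ((n : ℂ) + 1) ^ s‖ ≤ 1 / ((n + 1 : ℕ) : ℝ) ^ 2 := by
    intro n
    rw [norm_div, norm_one, show ((n : ℂ) + 1) = (((n + 1 : ℕ) : ℝ) : ℂ) by push_cast; rfl,
      Complex.norm_cpow_eq_rpow_re_of_pos (by positivity), ← Real.rpow_natCast]
    gcongr
    · simp
    · exact_mod_cast hs
  have hsum := (hasSum_nat_add_iff' 1).2 hasSum_zeta_two
  simp only [Finset.range_one, Finset.sum_singleton, Nat.cast_zero] at hsum
  norm_num at hsum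
  have hS : Summable fun n : ℕ => 1 / ((n : ℂ) + 1) ^ s :=
    Summable.of_norm_bounded (g := fun n : ℕ => 1 / ((n + 1 : ℕ) : ℝ) ^ 2)
      (by simpa using hsum.summable) hterm
  rw [zeta_eq_tsum_one_div_nat_add_one_cpow (by linarith), hS.tsum_eq_zero_add]
  have htail : HasSum (fun n : ℕ => 1 / ((n + 1 + 1 : ℕ) : ℝ) ^ 2) (Real.pi ^ 2 / 6 - 1) := by
    have := (hasSum_nat_add_iff' 1).2 hsum
    simpa using this
  have hle := tsum_of_norm_bounded htail fun n => hterm (n + 1)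
  have hpi : Real.pi ^ 2 / 6 - 1 ≤ 3 / 4 := by
    nlinarith [Real.pi_lt_d2, Real.pi_pos]
  have := norm_sub_le_norm_add (1 : ℂ) (∑' n : ℕ, 1 / (((n + 1 : ℕ) : ℂ) + 1) ^ s)
  simp only [Nat.cast_zero, zero_add, Complex.one_cpow, div_one, norm_one] at this ⊢
  linarith

theorem quarter_mul_norm_le_norm_regZeta {s : ℂ} (hs : 2 ≤ s.re) :
    ‖s - 1‖ / 4 ≤ ‖regZeta s‖ := by
  rw [regZeta_eq (by linarith) (by rintro rfl; norm_num at hs), norm_mul]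
  nlinarith [quarter_le_norm_riemannZeta hs, norm_nonneg (s - 1)]

theorem RiemannHypothesis.regZeta_ne_zero (h : RiemannHypothesis) {s : ℂ} (hs : 1 / 2 < s.re) :
    regZeta s ≠ 0 := by
  rcases eq_or_ne s 1 with rfl | hs1
  · simp [regZeta_one]
  · rw [regZeta_eq (by linarith) hs1]
    refine mul_ne_zero (sub_ne_zero.2 hs1) fun h0 => hs.ne' (h s h0 ?_ hs1)
    rintro ⟨n, rfl⟩
    simp at hs
    have : (0 : ℝ) ≤ n := n.cast_nonneg
    linarith

theorem RiemannHypothesis.quarter_le_norm_regZeta_mul_exp (h : RiemannHypothesis) {s : ℂ}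
    (hs : 1 / 2 < s.re) (hs2 : s.re ≤ 2) :
    1 / 4 ≤ ‖regZeta s‖ *
      Real.exp (3 * Real.log (12 * (4 + |s.im|) ^ 2) / (s.re - 1 / 2)) := by
  set c : ℂ := ⟨2, s.im⟩
  set M : ℝ := 4 + |s.im|
  have hM : 4 ≤ M := by simp [M]
  have hre : ∀ w ∈ Metric.ball c (3 / 2), 1 / 2 < w.re := fun w hw => by
    have := (abs_lt.1 ((Complex.abs_re_le_norm (w - c)).trans_lt (by
      simpa [dist_eq_norm] using hw))).1
    simp [c] at this
    linarith
  have hc : 1 / 4 ≤ ‖regZeta c‖ := by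
    have h1 := quarter_mul_norm_le_norm_regZeta (s := c) (by simp [c])
    have h2 := Complex.abs_re_le_norm (c - 1)
    norm_num [c] at h1 h2
    linarith
  have hsc : ‖s - c‖ = 2 - s.re := by
    have : s - c = ((s.re - 2 : ℝ) : ℂ) := by apply Complex.ext <;> simp [c]
    rw [this, Complex.norm_real, Real.norm_eq_abs, abs_of_nonpos (by linarith)]
    ring
  have key := norm_center_le_mul_exp (f := regZeta) (c := c) (z := s) (R := 3 / 2)
    (B := 12 * M ^ 2) (by norm_num) (by nlinarith)
    (fun w hw => (differentiableAt_regZeta (by linarith [hre w hw])).differentiableWithinAt)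
    (fun w hw => h.regZeta_ne_zero (hre w hw)) ?_ (by
      rw [Metric.mem_ball, dist_eq_norm, hsc]; linarith)
  · refine hc.trans (key.trans ?_)
    gcongr ‖regZeta s‖ * Real.exp ?_
    have hl : 0 ≤ Real.log (12 * M ^ 2) := Real.log_nonneg (by nlinarith)
    rw [hsc, show (3 / 2 - (2 - s.re) : ℝ) = s.re - 1 / 2 by ring]
    refine div_le_div_of_nonneg_right ?_ (by linarith)
    nlinarith
  · intro w hw
    have hw' : ‖w - c‖ < 3 / 2 := by simpa [dist_eq_norm] using hw
    have hcM : ‖c‖ ≤ 2 + |s.im| := by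
      simpa [c] using Complex.norm_le_abs_re_add_abs_im c
    have hc1M : ‖c - 1‖ ≤ 1 + |s.im| := by
      refine (Complex.norm_le_abs_re_add_abs_im (c - 1)).trans ?_
      norm_num [c]
    have h1 : ‖w‖ ≤ M := by
      have := norm_add_le (w - c) c
      rw [sub_add_cancel] at this
      linarith
    have h2 : ‖w - 1‖ ≤ M := by
      have := norm_add_le (w - c) (c - 1)
      rw [sub_add_sub_cancel] at this
      linarith
    have h3 : 1 / w.re ≤ 2 := by
      rw [div_le_iff₀ (by linarith [hre w hw])]; linarith [hre w hw]
    calc ‖regZeta w‖ ≤ ‖w‖ * ‖(1 : ℂ)‖ + ‖w‖ * ‖w - 1‖ * (1 / w.re) :=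
          norm_polarTailMellin_le norm_ofReal_fract_le (by linarith [hre w hw])
      _ ≤ M * 1 + M * M * 2 := by
          have := hre w hw
          rw [norm_one]
          gcongr
      _ ≤ 12 * M ^ 2 * ‖regZeta c‖ := by nlinarith

/-- A local Levinson-type estimate: a function which is holomorphic near the square
`|Re w| + |Im w| ≤ 1` and bounded there by `K exp (A / |Re w|)` is bounded by `2 K exp (4 A)` on
the real diagonal. -/
theorem norm_le_of_norm_le_exp_div_abs_re {f : ℂ → ℂ} {K A x : ℝ} (hf : Differentiable ℂ f)
    (hK : 0 ≤ K) (hA : 0 ≤ A)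
    (h : ∀ w : ℂ, |w.re| + |w.im| ≤ 1 → w.re ≠ 0 → ‖f w‖ ≤ K * Real.exp (A / |w.re|))
    (hx : |x| < 1) : ‖f x‖ ≤ 2 * K * Real.exp (4 * A) := by
  set U : Set ℂ := {w | |w.re| + |w.im| < 1}
  have hcont : Continuous fun w : ℂ => |w.re| + |w.im| := by fun_prop
  have hUo : IsOpen U := isOpen_lt hcont continuous_const
  have hcl : closure U ⊆ {w | |w.re| + |w.im| ≤ 1} := closure_lt_subset_le hcont continuous_const
  have hfr : frontier U ⊆ {w | |w.re| + |w.im| = 1} := frontier_lt_subset_eq hcont continuous_const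
  set q : ℂ → ℂ := fun w => 1 + w ^ 2
  have hqre : ∀ w, (q w).re = 1 + w.re ^ 2 - w.im ^ 2 := fun w => by simp [q, pow_two]; ring
  have hqim : ∀ w, (q w).im = 2 * w.re * w.im := fun w => by simp [q, pow_two]; ring
  have hqre0 : ∀ w : ℂ, |w.re| + |w.im| ≤ 1 → 0 ≤ (q w).re := fun w hw => by
    have : |w.im| ≤ 1 := by linarith [abs_nonneg w.re]
    have : w.im ^ 2 ≤ 1 := (sq_le_one_iff_abs_le_one _).2 this
    rw [hqre]; nlinarith [sq_nonneg w.re]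
  have hnexp : ∀ w : ℂ, ‖Complex.exp (-(4 * A) / q w)‖
      = Real.exp (-(4 * A * ((q w).re / Complex.normSq (q w)))) := fun w => by
    rw [Complex.norm_exp, neg_div, Complex.neg_re, div_eq_mul_inv,
      show (4 * (A : ℂ)) = ((4 * A : ℝ) : ℂ) by push_cast; ring, Complex.re_ofReal_mul,
      Complex.inv_re]
  have hle1 : ∀ w : ℂ, |w.re| + |w.im| ≤ 1 → ‖Complex.exp (-(4 * A) / q w)‖ ≤ 1 := fun w hw => by
    rw [hnexp, Real.exp_le_one_iff, neg_nonpos]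
    exact mul_nonneg (by positivity) (div_nonneg (hqre0 w hw) (Complex.normSq_nonneg _))
  set g : ℂ → ℂ := fun w => q w * Complex.exp (-(4 * A) / q w) * f w
  have hqd : Differentiable ℂ q := by fun_prop
  have hgd : ∀ w, q w ≠ 0 → DifferentiableAt ℂ g w := fun w hw => by
    have := hqd w
    have := hf w
    simp only [g]
    fun_prop (disch := assumption)
  have hg : DiffContOnCl ℂ g U := by
    constructor
    · intro w hw
      refine (hgd w fun h0 => ?_).differentiableWithinAt
      have h1 : |w.re| + |w.im| < 1 := hw
      have h2 : |w.im| < 1 := by linarith [abs_nonneg w.re]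
      have h3 : w.im ^ 2 < 1 := (sq_lt_one_iff_abs_lt_one _).2 h2
      have := hqre w
      rw [h0, Complex.zero_re] at this
      nlinarith [sq_nonneg w.re]
    · intro w hw
      by_cases h0 : q w = 0
      · have hgw : g w = 0 := by simp [g, h0]
        rw [ContinuousWithinAt, hgw]
        have ht : Tendsto (fun w => ‖q w * f w‖) (𝓝[closure U] w) (𝓝 0) := by
          have : Continuous fun w => ‖q w * f w‖ := (hqd.continuous.mul hf.continuous).norm
          have := this.tendsto w
          simp only [h0, zero_mul, norm_zero] at this
          exact this.mono_left nhdsWithin_le_nhds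
        refine squeeze_zero_norm' ?_ ht
        filter_upwards [self_mem_nhdsWithin] with z hz
        simp only [g, norm_mul]
        have := hle1 z (hcl hz)
        gcongr
        exact mul_le_of_le_one_right (norm_nonneg _) this
      · exact (hgd w h0).continuousAt.continuousWithinAt
  have hbdd : Bornology.IsBounded U := by
    refine (Metric.isBounded_closedBall (x := (0 : ℂ)) (r := 1)).subset fun w hw => ?_
    have h1 : |w.re| + |w.im| < 1 := hw
    simpa using (Complex.norm_le_abs_re_add_abs_im w).trans h1.le
  have hbound : ∀ w ∈ frontier U, ‖g w‖ ≤ 2 * K := by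
    intro w hw
    have hw1 : |w.re| + |w.im| = 1 := hfr hw
    rcases eq_or_ne w.re 0 with h0 | h0
    · have : q w = 0 := by
        have hi : |w.im| = 1 := by simpa [h0] using hw1
        have hi : w.im ^ 2 = 1 := by rw [← sq_abs, hi, one_pow]
        apply Complex.ext
        · rw [hqre, h0, hi]; simp
        · rw [hqim, h0]; simp
      simp only [g, this, zero_mul, norm_zero]
      positivity
    · have hpos : 0 < |w.re| := abs_pos.2 h0
      have hre : (q w).re = 2 * |w.re| := by
        rw [hqre, ← sq_abs w.re, ← sq_abs w.im, show |w.im| = 1 - |w.re| by linarith]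
        ring
      have him1 : |w.im| ≤ 1 := by linarith
      have hns : Complex.normSq (q w) ≤ 8 * |w.re| ^ 2 := by
        rw [Complex.normSq_apply, hre, hqim]
        have : w.im ^ 2 ≤ 1 := (sq_le_one_iff_abs_le_one _).2 him1
        rw [show 2 * w.re * w.im * (2 * w.re * w.im) = 4 * w.re ^ 2 * w.im ^ 2 by ring,
          ← sq_abs w.re]
        nlinarith [sq_nonneg |w.re|]
      have hns0 : 0 < Complex.normSq (q w) := Complex.normSq_pos.2 fun h => by
        rw [h, Complex.zero_re] at hre; linarith
      have hq2 : ‖q w‖ ≤ 2 := by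
        refine (norm_add_le _ _).trans ?_
        rw [norm_one, norm_pow]
        have : ‖w‖ ≤ 1 := (Complex.norm_le_abs_re_add_abs_im w).trans hw1.le
        nlinarith [norm_nonneg w]
      have hexp : A / |w.re| ≤ 4 * A * ((q w).re / Complex.normSq (q w)) := by
        have : 1 / |w.re| ≤ 4 * ((q w).re / Complex.normSq (q w)) := by
          rw [hre, div_le_iff₀ hpos, ← mul_div_assoc, div_mul_eq_mul_div, le_div_iff₀ hns0]
          nlinarith
        calc A / |w.re| = A * (1 / |w.re|) := by ring
          _ ≤ A * (4 * ((q w).re / Complex.normSq (q w))) := by gcongr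
          _ = _ := by ring
      calc ‖g w‖ = ‖q w‖ * (‖Complex.exp (-(4 * A) / q w)‖ * ‖f w‖) := by
            simp only [g, norm_mul, mul_assoc]
        _ ≤ 2 * (Real.exp (-(A / |w.re|)) * (K * Real.exp (A / |w.re|))) := by
            gcongr
            · rw [hnexp]; gcongr
            · exact h w hw1.le h0
        _ = 2 * K := by
            rw [mul_left_comm (Real.exp _), ← Real.exp_add, neg_add_cancel, Real.exp_zero]; ring
  have hxU : (x : ℂ) ∈ U := by simpa [U] using hx
  have key := Complex.norm_le_of_forall_mem_frontier_norm_le hbdd hg hbound (subset_closure hxU)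
  have hqx : q x = ((1 + x ^ 2 : ℝ) : ℂ) := by simp [q]
  have h1 : (1 : ℝ) ≤ ‖q x‖ := by
    rw [hqx, Complex.norm_real, Real.norm_of_nonneg (by positivity)]
    nlinarith [sq_nonneg x]
  have h2 : Real.exp (-(4 * A)) ≤ ‖Complex.exp (-(4 * A) / q x)‖ := by
    rw [hnexp, hqx, Complex.normSq_ofReal, Complex.ofReal_re]
    refine Real.exp_le_exp.2 (neg_le_neg (mul_le_of_le_one_right (by positivity) ?_))
    rw [div_le_one (by positivity)]
    nlinarith [sq_nonneg x, sq_nonneg (x ^ 2)]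
  have h3 : Real.exp (-(4 * A)) * ‖f x‖ ≤ 2 * K := by
    refine le_trans ?_ key
    simp only [g, norm_mul]
    gcongr
    nlinarith [norm_nonneg (Complex.exp (-(4 * A) / q x))]
  rw [Real.exp_neg, inv_mul_le_iff₀ (Real.exp_pos _)] at h3
  linarith

/-- A polynomially bounded entire function tending to zero along the negative real axis vanishes. -/
theorem eq_zero_of_polynomial_growth (k : ℕ) {F : ℂ → ℂ} {C : ℝ} (hF : Differentiable ℂ F)
    (hC : ∀ s, ‖F s‖ ≤ C * (1 + ‖s‖) ^ k)
    (h0 : Tendsto (fun x : ℝ => F (-x)) atTop (𝓝 0)) : ∀ s, F s = 0 := by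
  have const : ∀ {F : ℂ → ℂ}, Tendsto (fun x : ℝ => F (-x)) atTop (𝓝 0) →
      (∃ c, ∀ s, F s = c) → ∀ s, F s = 0 := by
    rintro F h0 ⟨c, hc⟩ s
    simp only [hc] at h0 ⊢
    exact tendsto_const_nhds_iff.1 h0
  induction k generalizing F C with
  | zero =>
    refine const h0 (hF.exists_const_forall_eq_of_bounded ?_)
    refine (isBounded_iff_forall_norm_le).2 ⟨C, ?_⟩
    rintro _ ⟨s, rfl⟩
    simpa using hC s
  | succ k ih =>
    have hGd : Differentiable ℂ (dslope F 0) := by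
      rw [← differentiableOn_univ, Complex.differentiableOn_dslope univ_mem, differentiableOn_univ]
      exact hF
    obtain ⟨M, hM⟩ := (isCompact_closedBall (0 : ℂ) 1).exists_bound_of_continuousOn
      hGd.continuous.continuousOn
    have hM0 : 0 ≤ M := (norm_nonneg _).trans (hM 0 (by simp))
    have hC0 : 0 ≤ C := by simpa using (norm_nonneg _).trans (hC 0)
    have hGs : ∀ s ≠ 0, dslope F 0 s = s⁻¹ * (F s - F 0) := fun s hs => by
      rw [dslope_of_ne _ hs, slope_def_module, sub_zero, smul_eq_mul]
    have hG0 := ih (F := dslope F 0) (C := M + 4 * C) hGd (fun s => ?_) ?_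
    · refine const h0 ⟨F 0, fun s => ?_⟩
      have := sub_smul_dslope F 0 s
      rw [hG0, smul_zero] at this
      exact (sub_eq_zero.1 this.symm)
    · have h1 : (1 : ℝ) ≤ (1 + ‖s‖) ^ k := one_le_pow₀ (by linarith [norm_nonneg s])
      rcases le_total ‖s‖ 1 with hs | hs
      · have := hM s (by simpa using hs)
        nlinarith
      · have hs0 : s ≠ 0 := by rintro rfl; norm_num at hs
        have e1 : ‖F s - F 0‖ ≤ 2 * C * (1 + ‖s‖) ^ (k + 1) := by
          have h2 : (1 : ℝ) ≤ (1 + ‖s‖) ^ (k + 1) := one_le_pow₀ (by linarith [norm_nonneg s])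
          have h3 := hC 0
          simp only [norm_zero, add_zero, one_pow, mul_one] at h3
          have := norm_sub_le (F s) (F 0)
          nlinarith [hC s]
        rw [hGs s hs0, norm_mul, norm_inv, inv_mul_le_iff₀ (by linarith)]
        refine e1.trans ?_
        rw [pow_succ]
        have h5 : 0 ≤ (1 + ‖s‖) ^ k := by positivity
        have h6 : 2 * C * (1 + ‖s‖) ≤ ‖s‖ * (M + 4 * C) := by nlinarith
        nlinarith
    · have h1 : Tendsto (fun x : ℝ => ((x⁻¹ : ℝ) : ℂ)) atTop (𝓝 0) := by
        have := (Complex.continuous_ofReal.tendsto 0).comp (tendsto_inv_atTop_zero (𝕜 := ℝ))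
        rwa [Complex.ofReal_zero] at this
      have h2 := (h1.neg).mul (h0.sub_const (F 0))
      simp only [neg_zero, zero_mul] at h2
      refine h2.congr' ?_
      filter_upwards [eventually_gt_atTop 0] with x hx
      rw [hGs _ (by simpa using hx.ne')]
      push_cast
      rw [inv_neg]

/-- The Mellin-type transform `∫₀¹ h(x) x^{-s} dx`. -/
noncomputable def unitMellin (h : ℝ → ℝ) (s : ℂ) : ℂ :=
  ∫ x in Ioo (0 : ℝ) 1, (h x : ℂ) * (x : ℂ) ^ (-s)

/-- The function `α ↦ ∫₀¹ {α / x} h(x) dx`. -/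
noncomputable def fractTransform (h : ℝ → ℝ) (α : ℝ) : ℝ :=
  ∫ x in Ioo (0 : ℝ) 1, Int.fract (α / x) * h x

theorem integrableOn_Ioo_rpow {τ : ℝ} (hτ : -1 < τ) :
    IntegrableOn (fun x : ℝ => x ^ τ) (Ioo 0 1) :=
  ((intervalIntegrable_iff_integrableOn_Ioc_of_le zero_le_one).1
    (intervalIntegral.intervalIntegrable_rpow' hτ)).mono_set Ioo_subset_Ioc_self

theorem integral_Ioo_rpow {τ : ℝ} (hτ : -1 < τ) :
    ∫ x in Ioo (0 : ℝ) 1, x ^ τ = 1 / (τ + 1) := by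
  rw [← integral_Ioc_eq_integral_Ioo, ← intervalIntegral.integral_of_le zero_le_one,
    integral_rpow (Or.inl hτ), Real.one_rpow, Real.zero_rpow (by linarith), sub_zero]

theorem norm_ofReal_mul_cpow (h : ℝ → ℝ) (s : ℂ) {x : ℝ} (hx : 0 < x) :
    ‖(h x : ℂ) * (x : ℂ) ^ (-s)‖ = |h x| * x ^ (-s.re) := by
  rw [norm_mul, Complex.norm_cpow_eq_rpow_re_of_pos hx, Complex.norm_real, Complex.neg_re,
    Real.norm_eq_abs]

theorem abs_mul_rpow_le (a : ℝ) {x τ b : ℝ} (hx : 0 < x) (hb : 0 < b) :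
    |a| * x ^ τ ≤ b * a ^ 2 + b⁻¹ * x ^ (2 * τ) := by
  have h2 : x ^ (2 * τ) = (x ^ τ) ^ 2 := by
    rw [← Real.rpow_natCast, ← Real.rpow_mul hx.le]; congr 1; push_cast; ring
  have h0 : 0 ≤ |a| * x ^ τ := mul_nonneg (abs_nonneg a) (Real.rpow_nonneg hx.le _)
  have e : b * a ^ 2 + b⁻¹ * (x ^ τ) ^ 2 - 2 * (|a| * x ^ τ) = b⁻¹ * (b * |a| - x ^ τ) ^ 2 := by
    rw [← sq_abs a]; field_simp; ring
  rw [h2]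
  have : 0 ≤ b⁻¹ * (b * |a| - x ^ τ) ^ 2 := by positivity
  linarith

section

variable {h : ℝ → ℝ}

theorem integrableOn_abs_mul_rpow (hm : Measurable h)
    (hh : MemLp h 2 (volume.restrict (Ioo (0 : ℝ) 1)))
    {τ : ℝ} (hτ : -(1 / 2) < τ) :
    IntegrableOn (fun x : ℝ => |h x| * x ^ τ) (Ioo 0 1) := by
  have hi := (hh.integrable_sq.const_mul 1).add
    ((integrableOn_Ioo_rpow (τ := 2 * τ) (by linarith)).const_mul 1⁻¹)
  refine Integrable.mono' hi (by fun_prop) ?_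
  refine (ae_restrict_iff' measurableSet_Ioo).2 (Eventually.of_forall fun x hx => ?_)
  rw [Real.norm_of_nonneg (mul_nonneg (abs_nonneg _) (Real.rpow_nonneg hx.1.le _))]
  exact abs_mul_rpow_le _ hx.1 one_pos

theorem norm_unitMellin_le (hh : MemLp h 2 (volume.restrict (Ioo (0 : ℝ) 1)))
    {s : ℂ} (hs : s.re < 1 / 2) :
    ‖unitMellin h s‖ ≤ ((∫ x in Ioo (0 : ℝ) 1, h x ^ 2) + 1) / √(1 / 2 - s.re) := by
  set δ := 1 / 2 - s.re
  have hδ : 0 < δ := by simp only [δ]; linarith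
  have hb : 0 < (√δ)⁻¹ := inv_pos.2 (Real.sqrt_pos.2 hδ)
  have hi := (hh.integrable_sq.const_mul (√δ)⁻¹).add
    ((integrableOn_Ioo_rpow (τ := 2 * (-s.re)) (by linarith)).const_mul (√δ)⁻¹⁻¹)
  refine (norm_integral_le_of_norm_le hi ((ae_restrict_iff' measurableSet_Ioo).2
    (Eventually.of_forall fun x hx => ?_))).trans ?_
  · rw [norm_ofReal_mul_cpow h s hx.1]
    exact abs_mul_rpow_le _ hx.1 hb
  · rw [integral_add' (hh.integrable_sq.const_mul _)
      ((integrableOn_Ioo_rpow (by linarith)).const_mul _), integral_const_mul, integral_const_mul,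
      integral_Ioo_rpow (by linarith), inv_inv,
      show 2 * -s.re + 1 = 2 * δ by simp only [δ]; ring]
    have h1 : √δ * (1 / (2 * δ)) = (√δ)⁻¹ / 2 := by
      nth_rewrite 2 [← Real.mul_self_sqrt hδ.le]
      have := (Real.sqrt_pos.2 hδ).ne'
      field_simp
    have h2 (I : ℝ) : (I + 1) / √δ = (√δ)⁻¹ * I + (√δ)⁻¹ := by ring
    rw [h1, h2]
    linarith

theorem differentiableAt_unitMellin (hm : Measurable h)
    (hh : MemLp h 2 (volume.restrict (Ioo (0 : ℝ) 1)))
    {s : ℂ} (hs : s.re < 1 / 2) :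
    DifferentiableAt ℂ (unitMellin h) s := by
  set f : ℝ → ℂ := (Ioo (0 : ℝ) 1).indicator fun x => (h x : ℂ)
  have hf : Measurable f := by
    have : Measurable fun x => (h x : ℂ) := by fun_prop
    exact this.indicator measurableSet_Ioo
  have key {τ : ℝ} (hτ : -(1 / 2) < τ) : IntegrableOn (fun t : ℝ => ‖f t‖ * t ^ τ) (Ioi 0) := by
    have : (fun t : ℝ => ‖f t‖ * t ^ τ) = (Ioo (0 : ℝ) 1).indicator fun t => |h t| * t ^ τ := by
      ext t
      by_cases ht : t ∈ Ioo (0 : ℝ) 1 <;> simp [f, ht]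
    rw [this]
    exact ((integrable_indicator_iff measurableSet_Ioo).2
      (integrableOn_abs_mul_rpow hm hh hτ)).integrableOn
  have heq : unitMellin h = (fun z : ℂ => ∫ t in Ioi (0 : ℝ), f t * (t : ℂ) ^ z) ∘ Neg.neg := by
    ext z
    have : (fun t : ℝ => f t * (t : ℂ) ^ (-z))
        = (Ioo (0 : ℝ) 1).indicator fun t => (h t : ℂ) * (t : ℂ) ^ (-z) := by
      ext t
      by_cases ht : t ∈ Ioo (0 : ℝ) 1 <;> simp [f, ht]
    simp only [unitMellin, Function.comp_apply, this]
    rw [setIntegral_indicator measurableSet_Ioo, inter_eq_right.2 Ioo_subset_Ioi_self]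
  rw [heq]
  have hε : 0 < (1 / 2 - s.re) / 4 := by linarith
  refine DifferentiableAt.comp s (differentiableAt_integral_mul_cpow hε
    hf.aestronglyMeasurable (key ?_) (key ?_)) differentiableAt_id.neg
  · simp only [Complex.neg_re]; linarith
  · simp only [Complex.neg_re]; linarith

theorem measurable_fractTransform (hm : Measurable h) :
    Measurable fun α => (fractTransform h α : ℂ) := by
  have : Measurable (Function.uncurry fun α x : ℝ => Int.fract (α / x) * h x) := by
    have := hm
    fun_prop
  exact Complex.measurable_ofReal.comp this.stronglyMeasurable.integral_prod_right.measurable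

theorem norm_fractTransform_le (hh : MemLp h 2 (volume.restrict (Ioo (0 : ℝ) 1)))
    (α : ℝ) :
    ‖(fractTransform h α : ℂ)‖ ≤ ∫ x in Ioo (0 : ℝ) 1, |h x| := by
  rw [Complex.norm_real]
  refine norm_integral_le_of_norm_le (hh.integrable one_le_two).abs
    (Eventually.of_forall fun x => ?_)
  rw [norm_mul, Real.norm_of_nonneg (Int.fract_nonneg _)]
  exact mul_le_of_le_one_left (norm_nonneg _) (Int.fract_lt_one _).le

/-- The Mellin transform of `α ↦ ∫₀¹ {α / x} h(x) dx` by Fubini. -/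
theorem mellin_fractTransform (hm : Measurable h)
    (hh : MemLp h 2 (volume.restrict (Ioo (0 : ℝ) 1)))
    {s : ℂ} (h0 : 0 < s.re) (hs : s.re < 1 / 2) :
    mellin (fun α => (fractTransform h α : ℂ)) (-s) = -riemannZeta s / s * unitMellin h s := by
  set f : ℝ → ℂ := fun t => ((Int.fract t : ℝ) : ℂ)
  obtain ⟨hconv, hval⟩ := mellinConvergent_fract h0 (by linarith : s.re < 1)
  have hfm : Measurable f := measurable_ofReal_fract
  have hscale : ∀ x ∈ Ioo (0 : ℝ) 1,
      mellin (fun t => f (x⁻¹ * t)) (-s) = (x : ℂ) ^ (-s) * (-riemannZeta s / s) := fun x hx => by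
    rw [mellin_comp_mul_left f (-s) (inv_pos.2 hx.1), hval, neg_neg, smul_eq_mul,
      Complex.ofReal_inv, Complex.inv_cpow_eq_ite, if_neg, Complex.cpow_neg]
    rw [Complex.arg_ofReal_of_nonneg hx.1.le]
    exact Real.pi_pos.ne
  have hnorm : ∀ x ∈ Ioo (0 : ℝ) 1, ∫ t in Ioi (0 : ℝ),
      ‖(h x : ℂ) * ((t : ℂ) ^ (-s - 1) • f (x⁻¹ * t))‖
        = |h x| * x ^ (-s.re) * ∫ t in Ioi (0 : ℝ), ‖(t : ℂ) ^ (-s - 1) • f t‖ := by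
    intro x hx
    have e : EqOn (fun t : ℝ => ‖(h x : ℂ) * ((t : ℂ) ^ (-s - 1) • f (x⁻¹ * t))‖)
        (fun t => |h x| * x ^ (-s.re - 1) *
          (fun u : ℝ => ‖(u : ℂ) ^ (-s - 1) • f u‖) (x⁻¹ * t)) (Ioi 0) := by
      intro t ht
      have ht : 0 < t := ht
      have hxt : 0 < x⁻¹ * t := mul_pos (inv_pos.2 hx.1) ht
      simp only [norm_mul, norm_smul, Complex.norm_cpow_eq_rpow_re_of_pos ht,
        Complex.norm_cpow_eq_rpow_re_of_pos hxt, Complex.norm_real, Real.norm_eq_abs]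
      simp only [Complex.sub_re, Complex.neg_re, Complex.one_re]
      rw [Real.mul_rpow (inv_nonneg.2 hx.1.le) ht.le, Real.inv_rpow hx.1.le]
      have := (Real.rpow_pos_of_pos hx.1 (-s.re - 1)).ne'
      field_simp
    have hscale' := integral_comp_mul_left_Ioi (fun u : ℝ => ‖(u : ℂ) ^ (-s - 1) • f u‖) 0
      (inv_pos.2 hx.1)
    rw [setIntegral_congr_fun measurableSet_Ioi e, integral_const_mul,
      hscale', mul_zero, inv_inv, smul_eq_mul,
      Real.rpow_sub_one hx.1.ne']
    have := hx.1.ne'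
    field_simp
  have hint : Integrable (Function.uncurry fun x t : ℝ =>
      (h x : ℂ) * ((t : ℂ) ^ (-s - 1) • f (x⁻¹ * t)))
      ((volume.restrict (Ioo (0 : ℝ) 1)).prod (volume.restrict (Ioi (0 : ℝ)))) := by
    rw [integrable_prod_iff (by simp only [Function.uncurry_def, smul_eq_mul]; fun_prop)]
    constructor
    · refine (ae_restrict_iff' measurableSet_Ioo).2 (Eventually.of_forall fun x hx => ?_)
      exact Integrable.const_mul (c := (h x : ℂ))
        ((MellinConvergent.comp_mul_left (f := f) (inv_pos.2 hx.1)).2 hconv)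
    · refine IntegrableOn.congr_fun ?_ (fun x hx => (hnorm x hx).symm) measurableSet_Ioo
      exact (integrableOn_abs_mul_rpow hm hh (by linarith)).mul_const _
  have hswap := integral_integral_swap hint
  have hL : ∫ x in Ioo (0 : ℝ) 1, ∫ t in Ioi (0 : ℝ),
      (h x : ℂ) * ((t : ℂ) ^ (-s - 1) • f (x⁻¹ * t)) = -riemannZeta s / s * unitMellin h s := by
    rw [unitMellin, ← integral_const_mul]
    refine setIntegral_congr_fun measurableSet_Ioo fun x hx => ?_
    have := hscale x hx
    simp only [mellin] at this
    simp only [integral_const_mul, this]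
    ring
  rw [← hL, hswap, mellin]
  refine setIntegral_congr_fun measurableSet_Ioi fun t ht => ?_
  simp only [smul_eq_mul, fractTransform, ← integral_complex_ofReal]
  rw [← integral_const_mul]
  congr 1 with x
  simp only [f, Complex.ofReal_mul, div_eq_inv_mul]
  ring

/-- If `h` annihilates all `ρ_α`, its Mellin-type transform times `(s - 1) ζ(s)` continues to the
half-plane `0 < Re s`. -/
theorem polarTailMellin_fractTransform (hm : Measurable h)
    (hh : MemLp h 2 (volume.restrict (Ioo (0 : ℝ) 1)))
    {c : ℝ} (hc : ∀ α : ℝ, 0 < α → α < 1 →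
    fractTransform h α = α * c) {s : ℂ} (h0 : 0 < s.re) (hs : s.re < 1 / 2) :
    polarTailMellin c (fun α => (fractTransform h α : ℂ)) s = regZeta s * unitMellin h s := by
  have hs0 : s ≠ 0 := by rintro rfl; simp at h0
  have hs1 : s ≠ 1 := by rintro rfl; norm_num at hs
  have hs1' : 1 - s ≠ 0 := sub_ne_zero.2 hs1.symm
  set G : ℝ → ℂ := fun α => (fractTransform h α : ℂ)
  have e1 : EqOn (fun t : ℝ => (t : ℂ) ^ (-s - 1) • G t)
      (fun t : ℝ => G t * (t : ℂ) ^ (-(s + 1))) (Ioi 1) := fun t ht => by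
    simp only [smul_eq_mul]
    rw [mul_comm, show -s - 1 = -(s + 1) by ring]
  have e2 : EqOn (fun t : ℝ => (t : ℂ) ^ (-s - 1) • G t)
      (fun t : ℝ => (t : ℂ) ^ (-s) * c) (Ioo 0 1) := fun t ht => by
    have ht0 : (t : ℂ) ≠ 0 := Complex.ofReal_ne_zero.2 ht.1.ne'
    simp only [G, hc t ht.1 ht.2, smul_eq_mul, Complex.cpow_sub _ _ ht0, Complex.cpow_one,
      Complex.ofReal_mul]
    field_simp
  have i1 : IntegrableOn (fun t : ℝ => (t : ℂ) ^ (-s - 1) • G t) (Ioi 1) :=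
    (integrableOn_mul_cpow (measurable_fractTransform hm)
      (norm_fractTransform_le hh) h0).congr_fun (fun t ht => (e1 ht).symm) measurableSet_Ioi
  have i2' : IntervalIntegrable (fun t : ℝ => (t : ℂ) ^ (-s)) volume 0 1 :=
    intervalIntegral.intervalIntegrable_cpow' (by simp; linarith)
  have i2 : IntegrableOn (fun t : ℝ => (t : ℂ) ^ (-s - 1) • G t) (Ioc 0 1) := by
    rw [integrableOn_Ioc_iff_integrableOn_Ioo]
    refine IntegrableOn.congr_fun ?_ (fun t ht => (e2 ht).symm) measurableSet_Ioo
    exact (((intervalIntegrable_iff_integrableOn_Ioc_of_le zero_le_one).1 i2').mono_set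
      Ioo_subset_Ioc_self).mul_const _
  have hne : -s + 1 ≠ 0 := by rwa [neg_add_eq_sub]
  have key := mellin_fractTransform hm hh h0 hs
  rw [mellin, ← Ioc_union_Ioi_eq_Ioi zero_le_one,
    setIntegral_union Ioc_disjoint_Ioi_same measurableSet_Ioi i2 i1,
    integral_Ioc_eq_integral_Ioo, setIntegral_congr_fun measurableSet_Ioo e2,
    setIntegral_congr_fun measurableSet_Ioi e1, integral_mul_const,
    ← integral_Ioc_eq_integral_Ioo, ← intervalIntegral.integral_of_le zero_le_one,
    integral_cpow (Or.inl (by simp; linarith))] at key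
  simp only [Complex.ofReal_one, Complex.one_cpow, Complex.ofReal_zero, Complex.zero_cpow hne]
    at key
  rw [regZeta_eq h0 hs1, polarTailMellin, tailMellin]
  have h2 : ∫ t in Ioi (1 : ℝ), G t * (t : ℂ) ^ (-(s + 1))
      = -riemannZeta s / s * unitMellin h s - (1 - 0) / (-s + 1) * c := by
    rw [← key]; ring
  rw [h2]
  field_simp
  ring

end

theorem RiemannHypothesis.regZeta_ne_zero_of_re_ne (h : RiemannHypothesis) {s : ℂ} (h0 : 0 < s.re)
    (hs : s.re ≠ 1 / 2) : regZeta s ≠ 0 := by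
  rcases eq_or_ne s 1 with rfl | hs1
  · simp [regZeta_one]
  · rw [regZeta_eq h0 hs1]
    refine mul_ne_zero (sub_ne_zero.2 hs1) fun hz => hs (h s hz ?_ hs1)
    rintro ⟨n, rfl⟩
    simp at h0
    have : (0 : ℝ) ≤ n := n.cast_nonneg
    linarith

/-- A quotient of analytic functions which grows at most like the inverse square root of the
distance along a horizontal ray ending at `s` has a removable singularity at `s`. -/
theorem exists_analyticAt_of_norm_le_div_sqrt {q : ℂ → ℂ} {s : ℂ} {C : ℝ} (hq : MeromorphicAt q s)
    (hC : ∀ᶠ ε : ℝ in 𝓝[>] 0, ‖q (s - ε)‖ ≤ C / √ε) :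
    ∃ g : ℂ → ℂ, AnalyticAt ℂ g s ∧ q =ᶠ[𝓝[≠] s] g := by
  by_contra! hcon
  have hlt : meromorphicOrderAt q s < 0 := by
    by_contra! h
    obtain ⟨g, hg, hqg⟩ := hq.meromorphicOrderAt_nonneg_iff.1 h
    exact hcon g hg hqg
  obtain ⟨n, hn⟩ := WithTop.ne_top_iff_exists.1 (hlt.trans_le le_top).ne
  obtain ⟨g, hg, hg0, hqg⟩ := (meromorphicOrderAt_eq_int_iff hq).1 hn.symm
  have hn0 : n ≤ -1 := by
    rw [← hn] at hlt
    have : n < 0 := by exact_mod_cast hlt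
    omega
  have hray : Tendsto (fun ε : ℝ => s - (ε : ℂ)) (𝓝[>] 0) (𝓝[≠] s) := by
    refine tendsto_nhdsWithin_iff.2 ⟨?_, ?_⟩
    · have : Continuous fun ε : ℝ => s - (ε : ℂ) := by fun_prop
      have := this.tendsto 0
      simp only [Complex.ofReal_zero, sub_zero] at this
      exact this.mono_left nhdsWithin_le_nhds
    · filter_upwards [self_mem_nhdsWithin] with ε hε
      have hε : 0 < ε := hε
      simpa using hε.ne'
  have hlim : Tendsto (fun ε : ℝ => ‖g (s - ε)‖) (𝓝[>] 0) (𝓝 ‖g s‖) :=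
    (hg.continuousAt.tendsto.mono_left nhdsWithin_le_nhds).norm.comp hray
  have hzero : Tendsto (fun ε : ℝ => C * √ε) (𝓝[>] 0) (𝓝 0) := by
    have : Continuous fun ε : ℝ => C * √ε := by fun_prop
    have := this.tendsto 0
    simp only [Real.sqrt_zero, mul_zero] at this
    exact this.mono_left nhdsWithin_le_nhds
  have hle : ‖g s‖ ≤ 0 := by
    refine le_of_tendsto_of_tendsto hlim hzero ?_
    filter_upwards [hC, hray.eventually hqg, self_mem_nhdsWithin,
      nhdsWithin_le_nhds (gt_mem_nhds (zero_lt_one' ℝ))] with ε h1 h2 h3 h4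
    have h3 : 0 < ε := h3
    rw [h2, sub_sub_cancel_left, norm_smul, norm_zpow, norm_neg, Complex.norm_real,
      Real.norm_of_nonneg h3.le] at h1
    have h5 : ε⁻¹ ≤ ε ^ n := by
      rw [← zpow_neg_one]
      exact zpow_le_zpow_right_of_le_one₀ h3 h4.le hn0
    have h6 : ε⁻¹ * ‖g (s - ε)‖ ≤ C / √ε :=
      (mul_le_mul_of_nonneg_right h5 (norm_nonneg _)).trans h1
    rw [inv_mul_le_iff₀ h3] at h6
    refine h6.trans (le_of_eq ?_)
    nth_rewrite 1 [← Real.mul_self_sqrt h3.le]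
    have := (Real.sqrt_pos.2 h3).ne'
    field_simp
  exact hg0 (norm_le_zero_iff.1 hle)

section

variable {H N : ℂ → ℂ} {C D : ℝ}

/-- Under RH, a function `H` on `Re s < 1 / 2` with `N = (s - 1) ζ H`, where `N` is holomorphic on
`0 < Re s`, extends to an entire function, provided it grows slowly near the critical line. -/
theorem RiemannHypothesis.exists_differentiable_extension (h : RiemannHypothesis)
    (hH : ∀ s : ℂ, s.re < 1 / 2 → DifferentiableAt ℂ H s)
    (hHC : ∀ s : ℂ, s.re < 1 / 2 → ‖H s‖ ≤ C / √(1 / 2 - s.re))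
    (hN : ∀ s : ℂ, 0 < s.re → DifferentiableAt ℂ N s)
    (heq : ∀ s : ℂ, 0 < s.re → s.re < 1 / 2 → N s = regZeta s * H s) :
    ∃ F : ℂ → ℂ, Differentiable ℂ F ∧ (∀ s : ℂ, s.re < 1 / 2 → F s = H s) ∧
      ∀ s : ℂ, 1 / 2 < s.re → N s = regZeta s * F s := by
  classical
  set q : ℂ → ℂ := fun s => N s / regZeta s
  have hqH : ∀ s : ℂ, 0 < s.re → s.re < 1 / 2 → q s = H s := fun s h0 hs => by
    simp only [q, heq s h0 hs]
    rw [mul_div_cancel_left₀ _ (h.regZeta_ne_zero_of_re_ne h0 hs.ne)]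
  have hre : IsOpen {s : ℂ | 0 < s.re} := isOpen_lt continuous_const Complex.continuous_re
  have hlt : IsOpen {s : ℂ | s.re < 1 / 2} := isOpen_lt Complex.continuous_re continuous_const
  set F : ℂ → ℂ := fun s => if s.re < 1 / 2 then H s else limUnder (𝓝[≠] s) q
  have hFH : ∀ s : ℂ, s.re < 1 / 2 → F s = H s := fun s hs => if_pos hs
  have hNan : ∀ s : ℂ, 0 < s.re → AnalyticAt ℂ N s := fun s hs =>
    DifferentiableOn.analyticAt (s := {s : ℂ | 0 < s.re})
      (fun z hz => (hN z hz).differentiableWithinAt) (hre.mem_nhds hs)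
  have hZan : ∀ s : ℂ, 0 < s.re → AnalyticAt ℂ regZeta s := fun s hs =>
    DifferentiableOn.analyticAt (s := {s : ℂ | 0 < s.re})
      (fun z hz => (differentiableAt_regZeta hz).differentiableWithinAt) (hre.mem_nhds hs)
  have hext : ∀ s : ℂ, 1 / 2 ≤ s.re → ∃ g : ℂ → ℂ, AnalyticAt ℂ g s ∧ q =ᶠ[𝓝[≠] s] g := by
    intro s hs
    rcases hs.lt_or_eq with hs | hs
    · exact ⟨q, (hNan s (by linarith)).div (hZan s (by linarith)) (h.regZeta_ne_zero hs),
        EventuallyEq.rfl⟩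
    · refine exists_analyticAt_of_norm_le_div_sqrt (C := C)
        ((hNan s (by linarith)).meromorphicAt.div (hZan s (by linarith)).meromorphicAt) ?_
      filter_upwards [self_mem_nhdsWithin,
        nhdsWithin_le_nhds (gt_mem_nhds (by norm_num : (0 : ℝ) < 1 / 2))] with ε h1 h2
      have h1 : 0 < ε := h1
      have e : (s - ε).re = 1 / 2 - ε := by simp [← hs]
      have := hHC (s - ε) (by linarith)
      rw [e, sub_sub_cancel] at this
      rwa [← hqH _ (by linarith) (by linarith)] at this
  have hlim : ∀ (s : ℂ) (g : ℂ → ℂ), 1 / 2 ≤ s.re → ContinuousAt g s → q =ᶠ[𝓝[≠] s] g →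
      F s = g s := by
    intro s g hs hg hqg
    simp only [F, if_neg hs.not_gt]
    exact ((hg.tendsto.mono_left nhdsWithin_le_nhds).congr' hqg.symm).limUnder_eq
  refine ⟨F, fun s => ?_, hFH, fun s hs => ?_⟩
  · rcases lt_or_ge s.re (1 / 2) with hs | hs
    · exact (hH s hs).congr_of_eventuallyEq (by
        filter_upwards [hlt.mem_nhds hs] with z hz using hFH z hz)
    · obtain ⟨g, hg, hqg⟩ := hext s hs
      refine hg.differentiableAt.congr_of_eventuallyEq ?_
      have hqg' := eventually_eventually_nhdsWithin.2 hqg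
      filter_upwards [eventually_nhdsWithin_iff.1 hqg, eventually_nhdsWithin_iff.1 hqg',
          hg.eventually_analyticAt,
        hre.mem_nhds (show 0 < s.re by linarith)] with z h1 h2 h3 h4
      rcases lt_or_ge z.re (1 / 2) with hz | hz
      · rw [hFH z hz, ← hqH z h4 hz]
        exact h1 (by rintro rfl; exact hs.not_gt hz)
      · refine hlim z g hz h3.continuousAt ?_
        rcases eq_or_ne z s with rfl | hzs
        · exact hqg
        · have := h2 hzs
          rw [isOpen_compl_singleton.nhdsWithin_eq hzs] at this
          exact this.filter_mono nhdsWithin_le_nhds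
  · have hZ := h.regZeta_ne_zero hs
    rw [hlim s q hs.le ((hNan s (by linarith)).div (hZan s (by linarith)) hZ).continuousAt
      EventuallyEq.rfl, mul_div_cancel₀ _ hZ]

theorem RiemannHypothesis.norm_le_of_regZeta_mul_eq (h : RiemannHypothesis) {F : ℂ → ℂ}
    (hNF : ∀ s : ℂ, 1 / 2 < s.re → N s = regZeta s * F s)
    {s : ℂ} (hs : 1 / 2 < s.re) (hs2 : s.re ≤ 2) :
    ‖F s‖ ≤ 4 * ‖N s‖ * Real.exp (3 * Real.log (12 * (4 + |s.im|) ^ 2) / (s.re - 1 / 2)) := by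
  have := h.quarter_le_norm_regZeta_mul_exp hs hs2
  rw [hNF s hs, norm_mul]
  nlinarith [norm_nonneg (F s)]

/-- Under RH, an entire `F` with `N = (s - 1) ζ F` grows polynomially when `N` does on
`1 / 2 ≤ Re s` and `F` is controlled to the left of the critical line. -/
theorem RiemannHypothesis.polynomial_growth (h : RiemannHypothesis) {F : ℂ → ℂ}
    (hF : Differentiable ℂ F) (hC : 0 ≤ C) (hD : 0 ≤ D)
    (hFC : ∀ s : ℂ, s.re < 1 / 2 → ‖F s‖ ≤ C / √(1 / 2 - s.re))
    (hNF : ∀ s : ℂ, 1 / 2 < s.re → N s = regZeta s * F s)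
    (hND : ∀ s : ℂ, 1 / 2 ≤ s.re → ‖N s‖ ≤ D * (1 + ‖s‖) ^ 2) (s : ℂ) :
    ‖F s‖ ≤ (200 * 300 ^ 12 * (C + D)) * (1 + ‖s‖) ^ 26 := by
  set B := 1 + ‖s‖
  have hB : 1 ≤ B := by simp [B]
  have him : |s.im| ≤ ‖s‖ := Complex.abs_im_le_norm s
  have hBpow (k : ℕ) : 1 ≤ B ^ k := one_le_pow₀ hB
  rcases le_or_gt s.re (-(1 / 2)) with h1 | h1
  · refine (hFC s (by linarith)).trans ((div_le_self hC ?_).trans ?_)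
    · rw [Real.one_le_sqrt]; linarith
    · nlinarith [hBpow 26]
  rcases lt_or_ge s.re (3 / 2) with h2 | h2
  · set M := 5 + |s.im|
    have hM : 5 ≤ M := by simp [M]
    have hMB : M ≤ 5 * B := by simp only [M, B]; linarith
    set A := 3 * Real.log (12 * M ^ 2)
    have hA : 1 ≤ A := by
      have : 1 ≤ Real.log (12 * M ^ 2) := by
        rw [Real.le_log_iff_exp_le (by positivity)]
        nlinarith [Real.exp_one_lt_three]
      simp only [A]; linarith
    set c : ℂ := ⟨1 / 2, s.im⟩
    have key := norm_le_of_norm_le_exp_div_abs_re (f := fun w => F (c + w))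
      (K := C + 4 * (D * M ^ 2)) (A := A) (x := s.re - 1 / 2) (by fun_prop) (by positivity)
      (by linarith) ?_ (by rw [abs_lt]; constructor <;> linarith)
    · have e : c + ((s.re - 1 / 2 : ℝ) : ℂ) = s := by apply Complex.ext <;> simp [c]
      simp only [e] at key
      have hexp : Real.exp (4 * A) = (12 * M ^ 2) ^ 12 := by
        rw [show 4 * A = (12 : ℕ) * Real.log (12 * M ^ 2) by simp only [A]; push_cast; ring,
          Real.exp_nat_mul, Real.exp_log (by positivity)]
      rw [hexp] at key
      calc ‖F s‖ ≤ 2 * (C + 4 * (D * M ^ 2)) * (12 * M ^ 2) ^ 12 := key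
        _ ≤ 2 * (C * B ^ 2 + 4 * (D * (5 * B) ^ 2)) * (12 * (5 * B) ^ 2) ^ 12 := by
          gcongr
          exact le_mul_of_one_le_right hC (hBpow 2)
        _ = (2 * C + 200 * D) * (300 ^ 12 * B ^ 26) := by ring
        _ ≤ (200 * C + 200 * D) * (300 ^ 12 * B ^ 26) := by gcongr; norm_num
        _ = _ := by ring
    · intro w hw hw0
      have hwre : |w.re| ≤ 1 := by linarith [abs_nonneg w.im]
      have hwim : |w.im| ≤ 1 := by linarith [abs_nonneg w.re]
      have hpos : 0 < |w.re| := abs_pos.2 hw0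
      have hcre : (c + w).re = 1 / 2 + w.re := by simp [c]
      have hcim : |(c + w).im| ≤ |s.im| + 1 := by
        simpa [c] using (abs_add_le s.im w.im).trans (by linarith)
      rcases hw0.lt_or_gt with hneg | hgt
      · have h3 := hFC (c + w) (by linarith)
        rw [hcre, sub_add_cancel_left, ← abs_of_neg hneg] at h3
        have h4 : 1 / √|w.re| ≤ Real.exp (A / |w.re|) := by
          calc 1 / √|w.re| ≤ 1 / |w.re| := by
                refine one_div_le_one_div_of_le hpos (Real.le_sqrt_of_sq_le ?_)
                nlinarith
            _ ≤ A / |w.re| := by gcongr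
            _ ≤ Real.exp (A / |w.re|) := by linarith [Real.add_one_le_exp (A / |w.re|)]
        calc ‖F (c + w)‖ ≤ C * (1 / √|w.re|) := by rwa [mul_one_div]
          _ ≤ (C + 4 * (D * M ^ 2)) * Real.exp (A / |w.re|) := by
            gcongr
            have : 0 ≤ D * M ^ 2 := by positivity
            linarith
      · have hwre' : w.re ≤ 1 := (le_abs_self _).trans hwre
        have h3 := h.norm_le_of_regZeta_mul_eq hNF (s := c + w) (by linarith) (by linarith)
        have h5 : ‖N (c + w)‖ ≤ D * M ^ 2 := by
          refine (hND _ (by linarith)).trans ?_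
          gcongr
          have := Complex.norm_le_abs_re_add_abs_im (c + w)
          rw [hcre, abs_of_pos (by linarith)] at this
          simp only [M]
          linarith
        rw [hcre, add_sub_cancel_left] at h3
        refine h3.trans ?_
        rw [abs_of_pos hgt]
        gcongr
        · have : 0 ≤ D * M ^ 2 := by positivity
          linarith
        · simp only [A]
          have h4 : 4 + |(c + w).im| ≤ M := by simp only [M]; linarith
          gcongr
  · have hs : 1 / 2 < s.re := by linarith
    set X := 12 * (4 + |s.im|) ^ 2
    have hX1 : 1 ≤ X := by simp only [X]; nlinarith [abs_nonneg s.im]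
    have hXB : X ≤ 12 * (4 * B) ^ 2 := by
      simp only [X]; gcongr; simp only [B]; linarith
    have h3 : 1 / 4 ≤ ‖regZeta s‖ * X ^ 3 := by
      rcases le_or_gt s.re 2 with h4 | h4
      · refine (h.quarter_le_norm_regZeta_mul_exp hs h4).trans ?_
        have : Real.exp (3 * Real.log X) = X ^ 3 := by
          rw [show 3 * Real.log X = (3 : ℕ) * Real.log X by norm_num, Real.exp_nat_mul,
            Real.exp_log (by linarith)]
        rw [← this]
        gcongr ‖regZeta s‖ * Real.exp ?_
        exact div_le_self (mul_nonneg (by norm_num) (Real.log_nonneg hX1)) (by linarith)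
      · have h5 := quarter_mul_norm_le_norm_regZeta h4.le
        have h6 := Complex.re_le_norm (s - 1)
        rw [Complex.sub_re, Complex.one_re] at h6
        refine le_trans ?_ (le_mul_of_one_le_right (norm_nonneg _) (one_le_pow₀ hX1))
        linarith
    calc ‖F s‖ ≤ 4 * (‖regZeta s‖ * X ^ 3 * ‖F s‖) := by nlinarith [norm_nonneg (F s)]
      _ = 4 * ‖N s‖ * X ^ 3 := by rw [hNF s hs, norm_mul]; ring
      _ ≤ 4 * (D * B ^ 2) * (12 * (4 * B) ^ 2) ^ 3 := by
        gcongr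
        exact hND s hs.le
      _ = 4 * 192 ^ 3 * D * B ^ 8 := by ring
      _ ≤ (200 * 300 ^ 12) * (C + D) * B ^ 26 := by
        have h5 : D ≤ C + D := le_add_of_nonneg_left hC
        have h6 : B ^ 8 ≤ B ^ 26 := pow_le_pow_right₀ hB (by norm_num)
        have h7 : (4 * 192 ^ 3 : ℝ) ≤ 200 * 300 ^ 12 := by norm_num
        exact mul_le_mul (mul_le_mul h7 h5 hD (by positivity)) h6 (by positivity) (by positivity)

theorem RiemannHypothesis.eq_zero_of_regZeta_mul_eq (h : RiemannHypothesis) (hC : 0 ≤ C)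
    (hD : 0 ≤ D)
    (hH : ∀ s : ℂ, s.re < 1 / 2 → DifferentiableAt ℂ H s)
    (hHC : ∀ s : ℂ, s.re < 1 / 2 → ‖H s‖ ≤ C / √(1 / 2 - s.re))
    (hN : ∀ s : ℂ, 0 < s.re → DifferentiableAt ℂ N s)
    (hND : ∀ s : ℂ, 1 / 2 ≤ s.re → ‖N s‖ ≤ D * (1 + ‖s‖) ^ 2)
    (heq : ∀ s : ℂ, 0 < s.re → s.re < 1 / 2 → N s = regZeta s * H s)
    {s : ℂ} (hs : s.re < 1 / 2) : H s = 0 := by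
  obtain ⟨F, hF, hFH, hNF⟩ := h.exists_differentiable_extension hH hHC hN heq
  rw [← hFH s hs]
  refine eq_zero_of_polynomial_growth 26 hF (h.polynomial_growth hF hC hD
    (fun s hs => by rw [hFH s hs]; exact hHC s hs) hNF hND) ?_ s
  have h0 : Tendsto (fun x : ℝ => C / √(1 / 2 + x)) atTop (𝓝 0) :=
    (Real.tendsto_sqrt_atTop.comp (tendsto_atTop_add_const_left _ _ tendsto_id)).const_div_atTop C
  refine squeeze_zero_norm' ?_ h0
  filter_upwards [eventually_gt_atTop 0] with x hx
  have hx' : (-x : ℂ).re < 1 / 2 := by simp; linarith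
  rw [hFH _ hx']
  simpa using hHC _ hx'

end

/-- An integrable function on `(0, 1)` whose moments all vanish is zero almost everywhere. -/
theorem ae_eq_zero_of_integral_pow_eq_zero {h : ℝ → ℝ} (hi : IntegrableOn h (Ioo 0 1))
    (h0 : ∀ n : ℕ, ∫ x in Ioo (0 : ℝ) 1, x ^ n * h x = 0) :
    h =ᵐ[volume.restrict (Ioo (0 : ℝ) 1)] 0 := by
  have hbdd {g : ℝ → ℝ} (hg : Continuous g) :
      IntegrableOn (fun x => g x * h x) (Ioo 0 1) := by
    obtain ⟨K, hK⟩ := isCompact_Icc.exists_bound_of_continuousOn (hg.continuousOn (s := Icc 0 1))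
    refine hi.bdd_mul hg.aestronglyMeasurable ((ae_restrict_iff' measurableSet_Ioo).2
      (Eventually.of_forall fun x hx => hK x (Ioo_subset_Icc_self hx)))
  have hpoly (p : Polynomial ℝ) : ∫ x in Ioo (0 : ℝ) 1, p.eval x * h x = 0 := by
    simp only [Polynomial.eval_eq_sum_range, Finset.sum_mul, mul_assoc]
    rw [integral_finsetSum _ fun n _ => (hbdd (continuous_pow n)).const_mul _]
    simp [integral_const_mul, h0]
  have hcont {g : ℝ → ℝ} (hg : Continuous g) : ∫ x in Ioo (0 : ℝ) 1, g x * h x = 0 := by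
    refine norm_le_zero_iff.1 (le_of_forall_pos_le_add fun ε hε => ?_)
    set M := ∫ x in Ioo (0 : ℝ) 1, ‖h x‖
    have hM : 0 ≤ M := integral_nonneg fun _ => norm_nonneg _
    obtain ⟨p, hp⟩ := exists_polynomial_near_of_continuousOn 0 1 g hg.continuousOn (ε / (M + 1))
      (by positivity)
    have e : ∫ x in Ioo (0 : ℝ) 1, g x * h x = ∫ x in Ioo (0 : ℝ) 1, (g x - p.eval x) * h x := by
      simp only [sub_mul]
      rw [integral_sub (hbdd hg) (hbdd p.continuous), hpoly, sub_zero]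
    calc ‖∫ x in Ioo (0 : ℝ) 1, g x * h x‖ ≤ ∫ x in Ioo (0 : ℝ) 1, ε / (M + 1) * ‖h x‖ := by
          rw [e]
          refine norm_integral_le_of_norm_le (hi.norm.const_mul _)
            ((ae_restrict_iff' measurableSet_Ioo).2 (Eventually.of_forall fun x hx => ?_))
          rw [norm_mul, norm_sub_rev]
          exact mul_le_mul_of_nonneg_right (hp x (Ioo_subset_Icc_self hx)).le (norm_nonneg _)
      _ = ε / (M + 1) * M := integral_const_mul _ _
      _ ≤ 0 + ε := by
          rw [zero_add, div_mul_eq_mul_div, div_le_iff₀ (by positivity)]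
          nlinarith
  refine (ae_restrict_iff' measurableSet_Ioo).2
    (isOpen_Ioo.ae_eq_zero_of_integral_contDiff_smul_eq_zero hi.locallyIntegrableOn
      fun g hg _ hsupp => ?_)
  rw [← setIntegral_eq_integral_of_forall_compl_eq_zero (s := Ioo 0 1) fun x hx => ?_]
  · exact hcont hg.continuous
  · rw [image_eq_zero_of_notMem_tsupport fun hxs => hx (hsupp hxs), zero_smul]

theorem RiemannHypothesis.ae_eq_zero_of_fractTransform_eq (hRH : RiemannHypothesis) {h : ℝ → ℝ}
    (hm : Measurable h) (hh : MemLp h 2 (volume.restrict (Ioo (0 : ℝ) 1))) {c : ℝ}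
    (hc : ∀ α : ℝ, 0 < α → α < 1 → fractTransform h α = α * c) :
    h =ᵐ[volume.restrict (Ioo (0 : ℝ) 1)] 0 := by
  set B := ∫ x in Ioo (0 : ℝ) 1, |h x|
  have hB : 0 ≤ B := integral_nonneg fun _ => abs_nonneg _
  have hS : 0 ≤ ∫ x in Ioo (0 : ℝ) 1, h x ^ 2 := integral_nonneg fun _ => sq_nonneg _
  have hbound (s : ℂ) (hs : 1 / 2 ≤ s.re) :
      ‖polarTailMellin c (fun α => (fractTransform h α : ℂ)) s‖
        ≤ (|c| + 2 * B) * (1 + ‖s‖) ^ 2 := by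
    refine (norm_polarTailMellin_le (norm_fractTransform_le hh) (by linarith)).trans ?_
    have h1 : ‖s - 1‖ ≤ 1 + ‖s‖ := (norm_sub_le s 1).trans (by rw [norm_one, add_comm])
    have h2 : B / s.re ≤ 2 * B := by
      rw [div_le_iff₀ (by linarith)]; nlinarith
    have h3 : ‖s‖ * ‖s - 1‖ * (B / s.re) ≤ (1 + ‖s‖) * (1 + ‖s‖) * (2 * B) := by
      have := norm_nonneg s
      have := div_nonneg hB (by linarith : 0 ≤ s.re)
      gcongr
      linarith
    have h4 : ‖s‖ * ‖(c : ℂ)‖ ≤ (1 + ‖s‖) ^ 2 * |c| := by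
      rw [Complex.norm_real, Real.norm_eq_abs]
      gcongr
      nlinarith [norm_nonneg s]
    linarith
  have key (n : ℕ) : unitMellin h (-n) = 0 :=
    hRH.eq_zero_of_regZeta_mul_eq (C := (∫ x in Ioo (0 : ℝ) 1, h x ^ 2) + 1) (D := |c| + 2 * B)
      (by positivity) (by positivity)
      (fun s hs => differentiableAt_unitMellin hm hh hs) (fun s hs => norm_unitMellin_le hh hs)
      (fun s hs => differentiableAt_polarTailMellin
        (measurable_fractTransform hm) (norm_fractTransform_le hh) hs) hbound
      (fun s h0 hs => polarTailMellin_fractTransform hm hh hc h0 hs) (by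
        have : (0 : ℝ) ≤ n := n.cast_nonneg
        simp only [Complex.neg_re, Complex.natCast_re]; linarith)
  refine ae_eq_zero_of_integral_pow_eq_zero (hh.integrable one_le_two) fun n => ?_
  have := key n
  simp only [unitMellin, neg_neg, Complex.cpow_natCast] at this
  rw [← Complex.ofReal_eq_zero, ← integral_complex_ofReal, ← this]
  congr 1 with x
  push_cast
  ring

theorem measurable_fract_div_sub (α : ℝ) :
    Measurable fun x : ℝ => Int.fract (α / x) - α * Int.fract (1 / x) := by
  fun_prop

theorem memLp_fract_div_sub (α : ℝ) :
    MemLp (fun x : ℝ => Int.fract (α / x) - α * Int.fract (1 / x)) 2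
      (volume.restrict (Ioo (0 : ℝ) 1)) := by
  refine MemLp.of_bound (C := 1 + |α|) (measurable_fract_div_sub α).aestronglyMeasurable
    (Eventually.of_forall fun x => ?_)
  have h (y : ℝ) : ‖Int.fract y‖ ≤ 1 := by
    rw [Real.norm_of_nonneg (Int.fract_nonneg _)]
    exact (Int.fract_lt_one _).le
  refine (norm_sub_le _ _).trans (add_le_add (h _) ?_)
  rw [norm_mul]
  exact mul_le_of_le_one_right (norm_nonneg _) (h _)

theorem integral_fract_div_sub_mul {h : ℝ → ℝ} (hi : IntegrableOn h (Ioo (0 : ℝ) 1)) (α : ℝ) :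
    ∫ x in Ioo (0 : ℝ) 1, (Int.fract (α / x) - α * Int.fract (1 / x)) * h x
      = fractTransform h α - α * fractTransform h 1 := by
  have hint (β : ℝ) : IntegrableOn (fun x : ℝ => Int.fract (β / x) * h x) (Ioo 0 1) := by
    refine hi.bdd_mul (c := 1) (Measurable.aestronglyMeasurable (by fun_prop))
      (Eventually.of_forall fun x => ?_)
    rw [Real.norm_of_nonneg (Int.fract_nonneg _)]
    exact (Int.fract_lt_one _).le
  simp only [sub_mul, mul_assoc]
  rw [integral_sub (hint α) ((hint 1).const_mul α), integral_const_mul]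
  rfl

/-- Duality: density means that only the zero function annihilates all `ρ_α`. -/
theorem dense_span_fract_div_sub_iff :
    Dense (↑(Submodule.span ℝ
        {g : Lp ℝ 2 (volume.restrict (Set.Ioo (0 : ℝ) 1)) |
          ∃ α : ℝ, 0 < α ∧ α < 1 ∧
            (g : ℝ → ℝ) =ᵐ[volume.restrict (Set.Ioo (0 : ℝ) 1)]
              fun x => Int.fract (α / x) - α * Int.fract (1 / x)}) :
        Set (Lp ℝ 2 (volume.restrict (Set.Ioo (0 : ℝ) 1)))) ↔
      ∀ h : ℝ → ℝ, Measurable h → MemLp h 2 (volume.restrict (Ioo (0 : ℝ) 1)) →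
        (∀ α : ℝ, 0 < α → α < 1 → fractTransform h α = α * fractTransform h 1) →
        h =ᵐ[volume.restrict (Ioo (0 : ℝ) 1)] 0 := by
  have hinner (g f : Lp ℝ 2 (volume.restrict (Ioo (0 : ℝ) 1))) (h : ℝ → ℝ) (α : ℝ)
      (hg : g =ᵐ[volume.restrict (Ioo (0 : ℝ) 1)]
        fun x => Int.fract (α / x) - α * Int.fract (1 / x))
      (hf : f =ᵐ[volume.restrict (Ioo (0 : ℝ) 1)] h) :
      inner ℝ g f = fractTransform h α - α * fractTransform h 1 := by
    have hfi : IntegrableOn h (Ioo (0 : ℝ) 1) := ((Lp.memLp f).integrable one_le_two).congr hf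
    rw [← integral_fract_div_sub_mul hfi, L2.inner_def]
    refine integral_congr_ae ?_
    filter_upwards [hg, hf] with x hx hx'
    rw [hx, hx']
    simp [mul_comm]
  rw [Submodule.dense_iff_topologicalClosure_eq_top, Submodule.topologicalClosure_eq_top_iff,
    Submodule.eq_bot_iff]
  constructor
  · intro H h hm hh hα
    have hz := H hh.toLp ((Submodule.mem_orthogonal _ _).2 fun u hu => ?_)
    · exact hh.coeFn_toLp.symm.trans ((Lp.eq_zero_iff_ae_eq_zero).1 hz)
    · induction hu using Submodule.span_induction with
      | mem g hg =>
        obtain ⟨α, h0, h1, hg⟩ := hg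
        rw [hinner g _ h α hg hh.coeFn_toLp, hα α h0 h1, sub_self]
      | zero => exact inner_zero_left _
      | add a b _ _ ha hb => rw [inner_add_left, ha, hb, add_zero]
      | smul r a _ ha => rw [real_inner_smul_left, ha, mul_zero]
  · intro H f hf
    refine Lp.eq_zero_iff_ae_eq_zero.2 (H f (Lp.stronglyMeasurable f).measurable (Lp.memLp f)
      fun α h0 h1 => ?_)
    have hρ := memLp_fract_div_sub α
    have := (Submodule.mem_orthogonal _ _).1 hf hρ.toLp
      (Submodule.subset_span ⟨α, h0, h1, hρ.coeFn_toLp⟩)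
    rw [hinner _ f f α hρ.coeFn_toLp (ae_eq_refl _)] at this
    linarith

/-- By the functional equation, RH follows from the absence of zeros in `1 / 2 < Re s < 1`. -/
theorem RiemannHypothesis.of_ne_zero
    (H : ∀ s : ℂ, 1 / 2 < s.re → s.re < 1 → riemannZeta s ≠ 0) : RiemannHypothesis := by
  have hright (s : ℂ) (hs : 1 / 2 < s.re) : riemannZeta s ≠ 0 := by
    rcases lt_or_ge s.re 1 with h | h
    · exact H s hs h
    · exact riemannZeta_ne_zero_of_one_le_re h
  intro s hz htriv _
  rcases lt_trichotomy s.re (1 / 2) with hlt | heq | hgt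
  · exfalso
    have hs0 : s ≠ 0 := by rintro rfl; norm_num [riemannZeta_zero] at hz
    have hre : 1 / 2 < (1 - s).re := by simp only [Complex.sub_re, Complex.one_re]; linarith
    have hfe := riemannZeta_one_sub (s := 1 - s)
      (fun n hn => by
        have hn' := congrArg Complex.re hn
        have : (0 : ℝ) ≤ n := n.cast_nonneg
        simp only [Complex.neg_re, Complex.natCast_re] at hn'
        linarith)
      (fun h1 => hs0 (by linear_combination -h1))
    rw [sub_sub_cancel, hz] at hfe
    have hpow : (2 * Real.pi : ℂ) ^ (-(1 - s)) ≠ 0 := by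
      rw [Ne, Complex.cpow_eq_zero_iff]
      have := Real.pi_ne_zero
      simp [this]
    have hcos : Complex.cos (Real.pi * (1 - s) / 2) = 0 := by
      simpa [hright _ hre, hpow, Complex.Gamma_ne_zero_of_re_pos (by linarith : 0 < (1 - s).re)]
        using hfe.symm
    obtain ⟨k, hk⟩ := Complex.cos_eq_zero_iff.1 hcos
    have hsk : s = -2 * k := by
      have hpi : (Real.pi : ℂ) ≠ 0 := Complex.ofReal_ne_zero.2 Real.pi_ne_zero
      have : (Real.pi : ℂ) * (1 - s) = Real.pi * (2 * k + 1) := by linear_combination 2 * hk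
      linear_combination -mul_left_cancel₀ hpi this
    have hkpos : 0 < k := by
      have h1 : s.re = -2 * k := by rw [hsk]; simp
      have h2 : (-1 : ℝ) < k := by
        have : (-1 / 4 : ℝ) < k := by linarith
        linarith
      have h3 : -1 < k := by exact_mod_cast h2
      rcases (by lia : k = 0 ∨ 0 < k) with rfl | h
      · simp at hsk; exact absurd hsk hs0
      · exact h
    refine htriv ⟨(k - 1).toNat, ?_⟩
    have : (((k - 1).toNat : ℤ) : ℂ) = ((k - 1 : ℤ) : ℂ) := by
      rw [Int.toNat_of_nonneg (by lia)]
    rw [Int.cast_natCast] at this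
    rw [this, hsk]
    push_cast
    ring
  · exact heq
  · exact absurd hz (hright s hgt)

theorem integrableOn_cpow_mul_fract_div {s : ℂ} (h0 : 0 < s.re) (h1 : s.re < 1) {α : ℝ}
    (hα : 0 < α) :
    IntegrableOn (fun x : ℝ => (x : ℂ) ^ (s - 1) * ((Int.fract (α / x) : ℝ) : ℂ)) (Ioi 0) := by
  have h := (mellinConvergent_fract h0 h1).1
  have h2 := (MellinConvergent.comp_rpow (s := s) (a := -1) (by norm_num)).2
    (show MellinConvergent _ (s / ((-1 : ℝ) : ℂ)) by simpa [div_neg] using h)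
  have h3 := (MellinConvergent.comp_mul_left (inv_pos.2 hα)).2 h2
  simpa [MellinConvergent, Real.rpow_neg_one, div_eq_mul_inv, mul_comm] using h3

theorem integral_cpow_mul_fract_div_eq_zero {s : ℂ} (h0 : 0 < s.re) (h1 : s.re < 1)
    (hz : riemannZeta s = 0) {α : ℝ} (hα : 0 < α) :
    ∫ x in Ioi (0 : ℝ), (x : ℂ) ^ (s - 1) * ((Int.fract (α / x) : ℝ) : ℂ) = 0 := by
  have h := (mellinConvergent_fract h0 h1).2
  rw [hz, neg_zero, zero_div, ← mellin_comp_inv] at h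
  have h3 := mellin_comp_mul_left (fun t : ℝ => ((Int.fract t⁻¹ : ℝ) : ℂ)) s (inv_pos.2 hα)
  rw [h, smul_zero] at h3
  simpa [mellin, div_eq_mul_inv, mul_comm] using h3

theorem integral_Ioo_cpow_mul_fract_div {s : ℂ} (h0 : 0 < s.re) (h1 : s.re < 1)
    (hz : riemannZeta s = 0) {α : ℝ} (hα : 0 < α) (hα1 : α ≤ 1) :
    ∫ x in Ioo (0 : ℝ) 1, (x : ℂ) ^ (s - 1) * ((Int.fract (α / x) : ℝ) : ℂ)
      = α * -∫ x in Ioi (1 : ℝ), (x : ℂ) ^ (s - 1) * (x : ℂ)⁻¹ := by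
  have hi := integrableOn_cpow_mul_fract_div h0 h1 hα
  have h := integral_cpow_mul_fract_div_eq_zero h0 h1 hz hα
  rw [← Ioc_union_Ioi_eq_Ioi zero_le_one,
    setIntegral_union Ioc_disjoint_Ioi_same measurableSet_Ioi
      (hi.mono_set Ioc_subset_Ioi_self) (hi.mono_set (Ioi_subset_Ioi zero_le_one)),
    integral_Ioc_eq_integral_Ioo] at h
  rw [eq_neg_of_add_eq_zero_left h, mul_neg, ← integral_const_mul]
  congr 1
  refine setIntegral_congr_fun measurableSet_Ioi fun x hx => ?_
  have hx : 1 < x := hx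
  have hx0 : 0 < x := by linarith
  have hlt : α / x < 1 := (div_lt_one hx0).2 (by linarith)
  simp only [Int.fract_eq_self.2 ⟨(div_pos hα hx0).le, hlt⟩, Complex.ofReal_div]
  ring

theorem fractTransform_clm_cpow (L : ℂ →L[ℝ] ℝ) {s : ℂ} (h0 : 0 < s.re) (h1 : s.re < 1)
    (hz : riemannZeta s = 0) {α : ℝ} (hα : 0 < α) (hα1 : α ≤ 1) :
    fractTransform (fun x => L ((x : ℂ) ^ (s - 1))) α
      = α * L (-∫ x in Ioi (1 : ℝ), (x : ℂ) ^ (s - 1) * (x : ℂ)⁻¹) := by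
  have hi := (integrableOn_cpow_mul_fract_div h0 h1 hα).mono_set
    (Ioo_subset_Ioi_self : Ioo (0 : ℝ) 1 ⊆ Ioi 0)
  have hL (a : ℝ) (z : ℂ) : L (a * z) = a * L z := by
    rw [← Complex.real_smul, map_smul, smul_eq_mul]
  rw [← hL, ← integral_Ioo_cpow_mul_fract_div h0 h1 hz hα hα1, ← L.integral_comp_comm hi,
    fractTransform]
  congr 1 with x
  rw [mul_comm, mul_comm _ (Complex.ofReal _), hL, mul_comm]

theorem memLp_clm_cpow (L : ℂ →L[ℝ] ℝ) {s : ℂ} (hs : 1 / 2 < s.re) :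
    MemLp (fun x : ℝ => L ((x : ℂ) ^ (s - 1))) 2 (volume.restrict (Ioo (0 : ℝ) 1)) := by
  have hm : Measurable fun x : ℝ => L ((x : ℂ) ^ (s - 1)) := by fun_prop
  refine (memLp_two_iff_integrable_sq hm.aestronglyMeasurable).2 ?_
  refine Integrable.mono' ((integrableOn_Ioo_rpow (τ := 2 * (s.re - 1)) (by linarith)).const_mul
    (‖L‖ ^ 2)) (hm.pow_const 2).aestronglyMeasurable ((ae_restrict_iff' measurableSet_Ioo).2
    (Eventually.of_forall fun x hx => ?_))
  have h := L.le_opNorm ((x : ℂ) ^ (s - 1))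
  rw [Complex.norm_cpow_eq_rpow_re_of_pos hx.1] at h
  rw [norm_pow, mul_comm 2, Real.rpow_mul hx.1.le, Real.rpow_two, ← mul_pow]
  exact pow_le_pow_left₀ (norm_nonneg _) h 2

theorem riemannZeta_ne_zero_of_fractTransform
    (H : ∀ h : ℝ → ℝ, Measurable h → MemLp h 2 (volume.restrict (Ioo (0 : ℝ) 1)) →
      (∀ α : ℝ, 0 < α → α < 1 → fractTransform h α = α * fractTransform h 1) →
      h =ᵐ[volume.restrict (Ioo (0 : ℝ) 1)] 0)
    {s : ℂ} (hs : 1 / 2 < s.re) (hs1 : s.re < 1) : riemannZeta s ≠ 0 := by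
  intro hz
  have h0 : 0 < s.re := by linarith
  have key (L : ℂ →L[ℝ] ℝ) : (fun x : ℝ => L ((x : ℂ) ^ (s - 1)))
      =ᵐ[volume.restrict (Ioo (0 : ℝ) 1)] 0 :=
    H _ (by fun_prop) (memLp_clm_cpow L hs) fun α hα hα1 => by
      rw [fractTransform_clm_cpow L h0 hs1 hz hα hα1.le,
        fractTransform_clm_cpow L h0 hs1 hz one_pos le_rfl, one_mul]
  have hne : (ae (volume.restrict (Ioo (0 : ℝ) 1))).NeBot := by
    rw [ae_neBot, Ne, Measure.restrict_eq_zero]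
    simp
  obtain ⟨x, ⟨hre, him⟩, hx⟩ := (((key Complex.reCLM).and (key Complex.imCLM)).and
    (ae_restrict_mem measurableSet_Ioo)).exists
  have hx0 : (x : ℂ) ^ (s - 1) = 0 := Complex.ext hre him
  exact hx.1.ne' (Complex.ofReal_eq_zero.1 ((Complex.cpow_eq_zero_iff _ _).1 hx0).1)

end NymanBeurling

/-- **Nyman–Beurling criterion.** The Riemann Hypothesis holds iff the
`ℝ`-linear span of the functions `ρ_α(x) = {α/x} − α·{1/x}`, `0 < α < 1`,
is dense in `L²((0,1))`. -/
theorem nyman_beurling_criterion :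
    RiemannHypothesis ↔
      Dense (↑(Submodule.span ℝ
        {g : Lp ℝ 2 (volume.restrict (Set.Ioo (0 : ℝ) 1)) |
          ∃ α : ℝ, 0 < α ∧ α < 1 ∧
            (g : ℝ → ℝ) =ᵐ[volume.restrict (Set.Ioo (0 : ℝ) 1)]
              fun x => Int.fract (α / x) - α * Int.fract (1 / x)}) :
        Set (Lp ℝ 2 (volume.restrict (Set.Ioo (0 : ℝ) 1)))) := by
  rw [dense_span_fract_div_sub_iff]
  exact ⟨fun hRH h hm hh hc => hRH.ae_eq_zero_of_fractTransform_eq hm hh hc,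
    fun H => RiemannHypothesis.of_ne_zero fun s hs hs1 =>
      riemannZeta_ne_zero_of_fractTransform H hs hs1⟩
end

section
/- For every natural number n, the product (5n)! · (3n)! · (2n)! divides (9n)! · n!. -/
open Nat

/-- The integer form of `⌊5x⌋ + ⌊3x⌋ + ⌊2x⌋ ≤ ⌊9x⌋ + ⌊x⌋` for rational `x = n / q`. -/
lemma div_add_div_add_div_le_nine_mul_div_add_div (n q : ℕ) :
    5 * n / q + 3 * n / q + 2 * n / q ≤ 9 * n / q + n / q := by
  obtain rfl | hq := q.eq_zero_or_pos
  · simp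
  have mul_div (c : ℕ) : c * n / q = c * (n / q) + c * (n % q) / q := by
    conv_lhs => rw [← Nat.div_add_mod n q, mul_add, mul_left_comm, Nat.mul_add_div hq]
  have hr := Nat.mod_lt n hq
  rw [mul_div 5, mul_div 3, mul_div 2, mul_div 9]
  generalize n % q = r at *
  suffices 5 * r / q + 3 * r / q + 2 * r / q ≤ 9 * r / q by lia
  rw [Nat.le_div_iff_mul_le hq]
  have h5 := Nat.div_mul_le_self (5 * r) q
  have h3 := Nat.div_mul_le_self (3 * r) q
  have h2 := Nat.div_mul_le_self (2 * r) q
  have l5 : 5 * r / q < 5 := Nat.div_lt_of_lt_mul (by lia)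
  have l3 : 3 * r / q < 3 := Nat.div_lt_of_lt_mul (by lia)
  have l2 : 2 * r / q < 2 := Nat.div_lt_of_lt_mul (by lia)
  generalize 5 * r / q = a at *
  generalize 3 * r / q = b at *
  generalize 2 * r / q = c at *
  interval_cases a <;> interval_cases b <;> interval_cases c <;> lia

theorem factorial_ratio_mmm_9_1_2_3_5 (n : ℕ) :
    (5 * n)! * (3 * n)! * (2 * n)! ∣ (9 * n)! * n ! := by
  have hne (m : ℕ) : m ! ≠ 0 := m.factorial_ne_zero
  rw [← Nat.factorization_prime_le_iff_dvd (by simp [hne]) (by simp [hne])]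
  intro p hp
  have legendre {m : ℕ} (hm : m ≤ 9 * n) :
      (m !).factorization p = ∑ i ∈ Finset.Ico 1 (Nat.log p (9 * n) + 1), m / p ^ i :=
    Nat.factorization_factorial hp (Nat.lt_succ_of_le (Nat.log_mono_right hm))
  simp only [Nat.factorization_mul, hne, ne_eq, not_false_eq_true,
    Finsupp.add_apply, or_self, mul_eq_zero]
  rw [legendre (m := 5 * n) (by lia), legendre (m := 3 * n) (by lia),
    legendre (m := 2 * n) (by lia), legendre (m := 9 * n) le_rfl, legendre (m := n) (by lia)]
  simp only [← Finset.sum_add_distrib]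
  exact Finset.sum_le_sum fun i _ ↦ div_add_div_add_div_le_nine_mul_div_add_div n (p ^ i)
end

section
/- For every natural number n, the product (9n)! · (7n)! · n! divides (14n)! · (3n)!. -/
open Nat

lemma Nat.mul_div_div_left (k m q : ℕ) (hk : 0 < k) : k * m / q / k = m / q := by
  rw [Nat.div_div_eq_div_mul, Nat.mul_comm q k, Nat.mul_div_mul_left _ _ hk]

lemma Nat.nine_seven_one_div_le_fourteen_three_div (n q : ℕ) (hq : 0 < q) :
    9 * n / q + 7 * n / q + n / q ≤ 14 * n / q + 3 * n / q := by
  have h₁ : 9 * n / q / 9 = n / q := Nat.mul_div_div_left 9 n q (by norm_num)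
  have h₃ : 9 * n / q / 3 = 3 * n / q := by
    rw [← Nat.mul_div_div_left 3 (3 * n) q (by norm_num), ← Nat.mul_assoc]
  have h₇ : 14 * n / q / 2 = 7 * n / q := by
    rw [← Nat.mul_div_div_left 2 (7 * n) q (by norm_num), ← Nat.mul_assoc]
  have h₁₄ : 14 * (9 * n / q) / 9 ≤ 14 * n / q := by
    rw [Nat.le_div_iff_mul_le hq]
    have h := Nat.div_mul_le_self (9 * n) q
    have h' := Nat.mul_le_mul_right q (Nat.div_mul_le_self (14 * (9 * n / q)) 9)
    linarith
  obtain ⟨c, hc⟩ : ∃ c, 9 * n / q % 9 = c := ⟨_, rfl⟩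
  have hc9 : c < 9 := hc ▸ Nat.mod_lt _ (by norm_num)
  interval_cases c <;> omega

theorem factorial_ratio_mmm_14_3_1_7_9 (n : ℕ) :
    (9 * n)! * (7 * n)! * n ! ∣ (14 * n)! * (3 * n)! := by
  have h₀ (k : ℕ) : k ! ≠ 0 := Nat.factorial_ne_zero k
  rw [← Nat.factorization_prime_le_iff_dvd
    (mul_ne_zero (mul_ne_zero (h₀ _) (h₀ _)) (h₀ _)) (mul_ne_zero (h₀ _) (h₀ _))]
  intro p hp
  have hlog (k : ℕ) (hk : k ≤ 14 * n) : Nat.log p k < Nat.log p (14 * n) + 1 :=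
    Nat.lt_succ_of_le (Nat.log_mono_right hk)
  rw [Nat.factorization_mul (mul_ne_zero (h₀ _) (h₀ _)) (h₀ _),
    Nat.factorization_mul (h₀ _) (h₀ _), Nat.factorization_mul (h₀ _) (h₀ _)]
  simp only [Finsupp.add_apply]
  rw [Nat.factorization_factorial hp (hlog (9 * n) (by omega)),
    Nat.factorization_factorial hp (hlog (7 * n) (by omega)),
    Nat.factorization_factorial hp (hlog n (by omega)),
    Nat.factorization_factorial hp (hlog (14 * n) le_rfl),
    Nat.factorization_factorial hp (hlog (3 * n) (by omega))]
  simp only [← Finset.sum_add_distrib]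
  exact Finset.sum_le_sum fun i _ ↦
    Nat.nine_seven_one_div_le_fourteen_three_div n (p ^ i) (pow_pos hp.pos i)
end

section
/- For every natural number n, the product (7n)! · (5n)! · (3n)! divides (14n)! · n!. -/
open Nat

set_option maxRecDepth 8000 in
theorem div_add_div_add_div_le_div_add_div (N : ℕ) :
    N / 30 + N / 42 + N / 70 ≤ N / 15 + N / 210 := by
  have key : ∀ r < 210, r / 30 + r / 42 + r / 70 ≤ r / 15 := by decide
  have := key (N % 210) (Nat.mod_lt _ (by norm_num))
  omega

theorem mul_div_sum_le_fourteen_mul_div_add_div (n m : ℕ) :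
    7 * n / m + 5 * n / m + 3 * n / m ≤ 14 * n / m + n / m := by
  have scale (c k : ℕ) (hc : 0 < c) (h : c * k = 210) : k * n / m = 210 * n / m / c := by
    rw [Nat.div_div_eq_div_mul, ← h, mul_assoc, mul_comm m c, Nat.mul_div_mul_left _ _ hc]
  have h1 := scale 210 1 (by norm_num) (by norm_num)
  rw [one_mul] at h1
  rw [scale 30 7 (by norm_num) (by norm_num), scale 42 5 (by norm_num) (by norm_num),
    scale 70 3 (by norm_num) (by norm_num), scale 15 14 (by norm_num) (by norm_num), h1]
  exact div_add_div_add_div_le_div_add_div _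

theorem factorial_ratio_mmm_14_1_3_5_7 (n : ℕ) :
    (7 * n)! * (5 * n)! * (3 * n)! ∣ (14 * n)! * n ! := by
  have hne (k : ℕ) : k ! ≠ 0 := Nat.factorial_ne_zero k
  rw [← Nat.factorization_prime_le_iff_dvd
    (mul_ne_zero (mul_ne_zero (hne _) (hne _)) (hne _)) (mul_ne_zero (hne _) (hne _))]
  intro p hp
  have legendre (k : ℕ) (hk : k ≤ 14 * n) :
      (k !).factorization p = ∑ i ∈ Finset.Ico 1 (Nat.log p (14 * n) + 1), k / p ^ i :=
    Nat.factorization_factorial hp (Nat.lt_succ_of_le (Nat.log_mono_right hk))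
  rw [Nat.factorization_mul (mul_ne_zero (hne _) (hne _)) (hne _),
    Nat.factorization_mul (hne _) (hne _), Nat.factorization_mul (hne _) (hne _)]
  simp only [Finsupp.add_apply]
  rw [legendre (7 * n) (by omega), legendre (5 * n) (by omega), legendre (3 * n) (by omega),
    legendre (14 * n) le_rfl, legendre n (by omega)]
  simp only [← Finset.sum_add_distrib]
  exact Finset.sum_le_sum fun i _ => mul_div_sum_le_fourteen_mul_div_add_div n (p ^ i)
end

section
/- For every natural number n, the product (10n)! · (9n)! · (4n)! divides (20n)! · (3n)!. -/
open Nat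

lemma floor_sum_le_of_lt {q r : ℕ} (hr : r < q) :
    10 * r / q + 9 * r / q + 4 * r / q ≤ 20 * r / q + 3 * r / q := by
  have hq : 0 < q := by omega
  have bounds (m : ℕ) : q * (m * r / q) ≤ m * r ∧ m * r < q * (m * r / q + 1) :=
    ⟨Nat.mul_div_le _ _, Nat.lt_mul_div_succ _ hq⟩
  have lt_of_pos {m : ℕ} (hm : 0 < m) : m * r / q < m :=
    Nat.div_lt_of_lt_mul (by nlinarith)
  obtain ⟨a₁, a₂⟩ := bounds 20
  obtain ⟨b₁, b₂⟩ := bounds 3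
  obtain ⟨c₁, -⟩ := bounds 10
  obtain ⟨d₁, d₂⟩ := bounds 9
  obtain ⟨e₁, e₂⟩ := bounds 4
  have ha := lt_of_pos (m := 20) (by norm_num)
  have hb := lt_of_pos (m := 3) (by norm_num)
  have hd := lt_of_pos (m := 9) (by norm_num)
  have he := lt_of_pos (m := 4) (by norm_num)
  generalize 20 * r / q = a at *
  generalize 3 * r / q = b at *
  generalize 10 * r / q = c at *
  generalize 9 * r / q = d at *
  generalize 4 * r / q = e at *
  have hc : 2 * c < a + 1 := Nat.lt_of_mul_lt_mul_left (a := q) (by linarith)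
  clear bounds lt_of_pos c₁
  interval_cases d <;> interval_cases e <;> first
    | omega
    | (interval_cases b <;> first
        | omega
        | (interval_cases a <;> omega))

lemma floor_sum_le (n : ℕ) {q : ℕ} (hq : 0 < q) :
    10 * n / q + 9 * n / q + 4 * n / q ≤ 20 * n / q + 3 * n / q := by
  have split (m : ℕ) : m * n / q = m * (n / q) + m * (n % q) / q := by
    conv_lhs => rw [← Nat.div_add_mod n q]
    rw [show m * (q * (n / q) + n % q) = m * (n % q) + q * (m * (n / q)) by ring,
      Nat.add_mul_div_left _ _ hq, add_comm]
  have h := floor_sum_le_of_lt (Nat.mod_lt n hq)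
  simp only [split]
  omega

theorem factorial_ratio_mmm_20_3_4_9_10 (n : ℕ) :
    (10 * n)! * (9 * n)! * (4 * n)! ∣ (20 * n)! * (3 * n)! := by
  have h₀ (m : ℕ) : m ! ≠ 0 := Nat.factorial_ne_zero m
  rw [← Nat.factorization_prime_le_iff_dvd (by simp [h₀]) (by simp [h₀])]
  intro p hp
  have key (m : ℕ) (hm : m ≤ 20) :
      (m * n)!.factorization p = ∑ i ∈ Finset.Ico 1 (Nat.log p (20 * n) + 1), m * n / p ^ i :=
    Nat.factorization_factorial hp
      (Nat.lt_succ_of_le (Nat.log_mono_right (Nat.mul_le_mul_right n hm)))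
  simp only [Nat.factorization_mul, h₀, ne_eq, not_false_eq_true, mul_eq_zero, or_self,
    Finsupp.add_apply]
  rw [key 10 (by norm_num), key 9 (by norm_num), key 4 (by norm_num), key 20 le_rfl,
    key 3 (by norm_num)]
  simp only [← Finset.sum_add_distrib]
  exact Finset.sum_le_sum fun i _ => floor_sum_le n (pow_pos hp.pos i)
end

section
/- For every natural number n, the product (15n)! · (10n)! · (6n)! divides (30n)! · n!. -/
open Nat

theorem div_two_add_div_three_add_div_five_le (k : ℕ) :
    k / 2 + k / 3 + k / 5 ≤ k + k / 30 := by
  omega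

theorem mul_div_add_mul_div_add_mul_div_le (n q : ℕ) :
    15 * n / q + 10 * n / q + 6 * n / q ≤ 30 * n / q + n / q := by
  have div_eq (a c : ℕ) (hc : 0 < c) (h : c * a = 30 * n) : a / q = 30 * n / q / c := by
    rw [← h, Nat.div_div_eq_div_mul, mul_comm q c, Nat.mul_div_mul_left _ _ hc]
  rw [div_eq (15 * n) 2 (by simp) (by ring), div_eq (10 * n) 3 (by simp) (by ring),
    div_eq (6 * n) 5 (by simp) (by ring), div_eq n 30 (by simp) rfl]
  exact div_two_add_div_three_add_div_five_le _

theorem factorial_ratio_mmm_30_1_6_10_15 (n : ℕ) :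
    (15 * n)! * (10 * n)! * (6 * n)! ∣ (30 * n)! * n ! := by
  have h0 := Nat.factorial_ne_zero
  rw [← Nat.factorization_prime_le_iff_dvd (by simp [h0]) (by simp [h0])]
  intro p hp
  have legendre (m : ℕ) (hm : m ≤ 30 * n) :
      (m !).factorization p = ∑ i ∈ Finset.Ico 1 (log p (30 * n) + 1), m / p ^ i :=
    Nat.factorization_factorial hp (Nat.lt_succ_of_le (Nat.log_mono_right hm))
  rw [Nat.factorization_mul (mul_ne_zero (h0 _) (h0 _)) (h0 _),
    Nat.factorization_mul (h0 _) (h0 _), Nat.factorization_mul (h0 _) (h0 _)]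
  simp only [Finsupp.add_apply]
  rw [legendre (15 * n) (by lia), legendre (10 * n) (by lia), legendre (6 * n) (by lia),
    legendre (30 * n) le_rfl, legendre n (by lia)]
  simp only [← Finset.sum_add_distrib]
  exact Finset.sum_le_sum fun i _ => mul_div_add_mul_div_add_mul_div_le n (p ^ i)
end

section
/- Let l be a prime number with l ≥ 11. Then for every integer k with 1 ≤ k ≤ l−1, one has {9k/l} + {k/l} + {−2k/l} + {−3k/l} + {−5k/l} ≥ 2. (Consequently, the stable quintuple (9, 1, −2, −3, −5) produces five terminal four-dimensional cyclic quotient singularities for every such l.) -/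
/-- The floor of `m / l` lies strictly below `m / l` when `l` does not divide `m`. -/
theorem Int.floor_intCast_div_natCast_lt {l : ℕ} (hl : l ≠ 0) {m : ℤ} (hm : ¬ (l : ℤ) ∣ m) :
    (⌊(m : ℚ) / l⌋ : ℚ) < (m : ℚ) / l := by
  refine lt_of_le_of_ne (Int.floor_le _) fun h => hm ⟨⌊(m : ℚ) / l⌋, ?_⟩
  have hl' : (l : ℚ) ≠ 0 := by exact_mod_cast hl
  rw [eq_div_iff hl', mul_comm] at h
  exact_mod_cast h.symm

/-- If `-2x`, `-3x` and `-5x` are not integers, the floors of `9x, -2x, -3x, -5x` add up to at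
most `-2`. -/
theorem floor_add_floor_le_neg_two {x : ℚ} (h0 : 0 < x) (h1 : x < 1)
    (h2 : (⌊-2 * x⌋ : ℚ) < -2 * x) (h3 : (⌊-3 * x⌋ : ℚ) < -3 * x)
    (h5 : (⌊-5 * x⌋ : ℚ) < -5 * x) :
    ⌊9 * x⌋ + ⌊-2 * x⌋ + ⌊-3 * x⌋ + ⌊-5 * x⌋ ≤ -2 := by
  have h9 := Int.floor_le (9 * x)
  have a1 : -2 ≤ ⌊-2 * x⌋ := Int.le_floor.2 (by push_cast; linarith)
  have b1 : -3 ≤ ⌊-3 * x⌋ := Int.le_floor.2 (by push_cast; linarith)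
  have c1 : -5 ≤ ⌊-5 * x⌋ := Int.le_floor.2 (by push_cast; linarith)
  have a2 : ⌊-2 * x⌋ < 0 := Int.floor_lt.2 (by push_cast; linarith)
  have b2 : ⌊-3 * x⌋ < 0 := Int.floor_lt.2 (by push_cast; linarith)
  have c2 : ⌊-5 * x⌋ < 0 := Int.floor_lt.2 (by push_cast; linarith)
  generalize ⌊9 * x⌋ = d at *
  generalize ⌊-2 * x⌋ = a at *
  generalize ⌊-3 * x⌋ = b at *
  generalize ⌊-5 * x⌋ = c at *
  by_contra! h
  have hd : (-1 : ℚ) ≤ d + a + b + c := by exact_mod_cast (by lia : -1 ≤ d + a + b + c)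
  interval_cases a <;> interval_cases b <;> interval_cases c <;> push_cast at * <;> linarith

/-- The stable quintuple `(9, 1, -2, -3, -5)` satisfies the terminality
condition for every prime `l ≥ 11`: for all `1 ≤ k ≤ l - 1`,
`{9k/l} + {k/l} + {-2k/l} + {-3k/l} + {-5k/l} ≥ 2`. -/
theorem stable_quintuple_terminality (l : ℕ) (hl : l.Prime) (hl11 : 11 ≤ l) :
    ∀ k : ℤ, 1 ≤ k → k ≤ (l : ℤ) - 1 →
      (2 : ℚ) ≤ Int.fract ((9 * k : ℚ) / l) + Int.fract ((k : ℚ) / l) +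
        Int.fract ((-2 * k : ℚ) / l) + Int.fract ((-3 * k : ℚ) / l) +
        Int.fract ((-5 * k : ℚ) / l) := by
  intro k hk1 hkl
  have hl0 : (0 : ℚ) < l := by exact_mod_cast hl.pos
  have hx0 : (0 : ℚ) < k / l := div_pos (by exact_mod_cast hk1) hl0
  have hx1 : (k : ℚ) / l < 1 := by
    rw [div_lt_one hl0]
    exact_mod_cast (by lia : k < l)
  have not_dvd (n : ℤ) (hn : 0 < n) (hn' : n < l) : ¬ (l : ℤ) ∣ -n * k := by
    rw [neg_mul, dvd_neg, (Nat.prime_iff_prime_int.1 hl).dvd_mul]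
    rintro (h | h) <;> have := Int.le_of_dvd (by lia) h <;> lia
  have floor_lt (n : ℤ) (hn : 0 < n) (hn' : n < l) :
      (⌊(-n : ℚ) * (k / l)⌋ : ℚ) < -n * (k / l) := by
    have := Int.floor_intCast_div_natCast_lt hl.ne_zero (not_dvd n hn hn')
    push_cast at this
    rwa [mul_div_assoc] at this
  have key := floor_add_floor_le_neg_two hx0 hx1
    (by exact_mod_cast floor_lt 2 (by lia) (by lia))
    (by exact_mod_cast floor_lt 3 (by lia) (by lia))
    (by exact_mod_cast floor_lt 5 (by lia) (by lia))
  have key' : (⌊9 * ((k : ℚ) / l)⌋ + ⌊-2 * ((k : ℚ) / l)⌋ + ⌊-3 * ((k : ℚ) / l)⌋ +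
      ⌊-5 * ((k : ℚ) / l)⌋ : ℚ) ≤ -2 := by exact_mod_cast key
  rw [Int.fract_eq_self.2 ⟨hx0.le, hx1⟩]
  simp only [mul_div_assoc, Int.fract]
  linarith
end

section
/- Let n_1, n_2, n_3 be positive integers with 1/n_1 = 1/n_2 + 1/n_3. Then for every real x ≥ 1, the value ⌊x/n_1⌋ − ⌊x/n_2⌋ − ⌊x/n_3⌋ lies in {0, 1}. -/
/-- The `d = 1` case of Vasyunin's classification: if `1/n₁ = 1/n₂ + 1/n₃`
for positive integers `n₁, n₂, n₃`, then `⌊x/n₁⌋ - ⌊x/n₂⌋ - ⌊x/n₃⌋ ∈ {0, 1}`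
for every real `x ≥ 1`. -/
theorem three_term_step_function (n₁ n₂ n₃ : ℕ)
    (h₁ : 0 < n₁) (h₂ : 0 < n₂) (h₃ : 0 < n₃)
    (h : (1 : ℚ) / n₁ = 1 / n₂ + 1 / n₃) :
    ∀ x : ℝ, 1 ≤ x →
      ⌊x / n₁⌋ - ⌊x / n₂⌋ - ⌊x / n₃⌋ = 0 ∨
      ⌊x / n₁⌋ - ⌊x / n₂⌋ - ⌊x / n₃⌋ = 1 := by
  intro x _
  have hR : (1 : ℝ) / n₁ = 1 / n₂ + 1 / n₃ := by
    simpa using congrArg (Rat.cast (K := ℝ)) h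
  have hx : x / n₁ = x / n₂ + x / n₃ := by
    rw [div_eq_mul_one_div, hR, mul_add, mul_one_div, mul_one_div]
  have hlower := Int.le_floor_add (x / n₂) (x / n₃)
  have hupper := Int.le_floor_add_floor (x / n₂) (x / n₃)
  rw [hx]
  omega
end
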